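/- arXiv:2310.16599 — 7 statements merged into one kernel-verified Lean document; each statement's English description precedes it below -/
import Mathlib

section
/- Let $(R,\mathfrak{m})$ be a commutative noetherian local ring and let $M, N$ be finitely generated $R$-modules. If $x_1,\dots,x_n \in \mathfrak{m}$ is a regular sequence on $M$, then $\operatorname{Ext}_R^i(M,N) = 0$ for all $i \gg 0$ if and only if $\operatorname{Ext}_R^i(M/(x_1,\dots,x_n)M, N) = 0$ for all $i \gg 0$. -/
open CategoryTheory IsLocalRing

noncomputable section

/-- The `i`-th Ext group of `R`-modules `M`, `N`, as a `ModuleCat R`. -/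
def ExtGroup (R : Type) [CommRing R] (i : ℕ) (M N : ModuleCat.{0} R) : ModuleCat R :=
  ((Ext R (ModuleCat.{0} R) i).obj (Opposite.op M)).obj N

/-- The `i`-th Tor group. -/
def TorGroup (R : Type) [CommRing R] (i : ℕ) (M N : ModuleCat.{0} R) : ModuleCat R :=
  ((Tor (ModuleCat.{0} R) i).obj M).obj N

/-- `Ext_R^i(M, N) = 0` for all `i ≫ 0`. -/
def ExtEventuallyZero (R : Type) [CommRing R] (M N : ModuleCat.{0} R) : Prop :=
  ∃ t : ℕ, ∀ i > t, Subsingleton (ExtGroup R i M N)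

/-- Property (ee). -/
def PropEE (R : Type) [CommRing R] : Prop :=
  ∀ M N : ModuleCat.{0} R, Module.Finite R M → Module.Finite R N →
    ExtEventuallyZero R M N → ExtEventuallyZero R N M

/-- Gorenstein: `Ext^i(k, R) = 0` for `i ≫ 0`. -/
def IsGorensteinLocalRing (R : Type) [CommRing R] [IsLocalRing R] : Prop :=
  ∃ t : ℕ, ∀ i > t, Subsingleton
    (ExtGroup R i (ModuleCat.of R (ResidueField R)) (ModuleCat.of R R))

open Classical in
/-- depth of a module over a local ring, with depth of zero module = ⊤. -/
def rdepth (R : Type) [CommRing R] [IsLocalRing R]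
    (M : Type) [AddCommGroup M] [Module R M] : ℕ∞ :=
  if Subsingleton M then ⊤ else
    sSup {n : ℕ∞ | ∃ rs : List R, (rs.length : ℕ∞) = n ∧
      (∀ r ∈ rs, r ∈ maximalIdeal R) ∧ RingTheory.Sequence.IsRegular M rs}

/-- Totally reflexive module. -/
def IsTotallyReflexive (R : Type) [CommRing R]
    (M : Type) [AddCommGroup M] [Module R M] : Prop :=
  Module.Finite R M ∧ Function.Bijective (Module.Dual.eval R M) ∧
  (∀ i > 0, Subsingleton (ExtGroup R i (ModuleCat.of R M) (ModuleCat.of R R))) ∧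
  (∀ i > 0, Subsingleton
    (ExtGroup R i (ModuleCat.of R (Module.Dual R M)) (ModuleCat.of R R)))

/-- Property (tr). -/
def PropTR (R : Type) [CommRing R] : Prop :=
  ∀ (M : Type) [AddCommGroup M] [Module R M], Module.Finite R M →
    (∀ i > 0, Subsingleton (ExtGroup R i (ModuleCat.of R M) (ModuleCat.of R R))) →
    IsTotallyReflexive R M

/-- Property (dep): the depth formula (written additively to avoid truncated subtraction). -/
def PropDep (R : Type) [CommRing R] [IsLocalRing R] : Prop :=
  ∀ (M N : Type) [AddCommGroup M] [Module R M] [AddCommGroup N] [Module R N],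
    Module.Finite R M → Module.Finite R N → Nontrivial M → Nontrivial N →
    (∀ i > 0, Subsingleton (TorGroup R i (ModuleCat.of R M) (ModuleCat.of R N))) →
    rdepth R (TensorProduct R M N) + rdepth R R = rdepth R M + rdepth R N

/-- AB ring. -/
def IsABRing (R : Type) [CommRing R] [IsLocalRing R] : Prop :=
  IsGorensteinLocalRing R ∧ ∃ n : ℕ, ∀ M N : ModuleCat.{0} R,
    Module.Finite R M → Module.Finite R N → ExtEventuallyZero R M N →
    ∀ i > n, Subsingleton (ExtGroup R i M N)

/-- A complex of finitely generated projective modules, indexed by `ℤ`. -/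
structure FGProjComplex (R : Type) [CommRing R] where
  X : ℤ → Type
  [acg : ∀ n, AddCommGroup (X n)]
  [mod : ∀ n, Module R (X n)]
  [fin : ∀ n, Module.Finite R (X n)]
  [proj : ∀ n, Module.Projective R (X n)]
  d : ∀ n : ℤ, X n →ₗ[R] X (n + 1)
  dd : ∀ n : ℤ, (d (n + 1)).comp (d n) = 0

attribute [instance] FGProjComplex.acg FGProjComplex.mod FGProjComplex.fin FGProjComplex.proj

/-- Acyclicity of such a complex. -/
def FGProjComplex.Acyclic {R : Type} [CommRing R] (C : FGProjComplex R) : Prop :=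
  ∀ n : ℤ, LinearMap.ker (C.d (n + 1)) = LinearMap.range (C.d n)

/-- The dual complex is acyclic. -/
def FGProjComplex.DualAcyclic {R : Type} [CommRing R] (C : FGProjComplex R) : Prop :=
  ∀ n : ℤ, LinearMap.ker ((C.d n).dualMap) = LinearMap.range ((C.d (n + 1)).dualMap)

/-- Property (tac): every acyclic complex of f.g. projective modules is totally acyclic. -/
def PropTAC (R : Type) [CommRing R] : Prop :=
  ∀ C : FGProjComplex R, C.Acyclic → C.DualAcyclic

/-- `M` is an ∞-syzygy. -/
def IsInfiniteSyzygy (R : Type) [CommRing R]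
    (M : Type) [AddCommGroup M] [Module R M] : Prop :=
  Module.Finite R M ∧
  ∃ (k : ℕ → ℕ) (f : M →ₗ[R] (Fin (k 0) → R))
    (d : ∀ n : ℕ, (Fin (k n) → R) →ₗ[R] (Fin (k (n + 1)) → R)),
    Function.Injective f ∧ LinearMap.ker (d 0) = LinearMap.range f ∧
    ∀ n : ℕ, LinearMap.ker (d (n + 1)) = LinearMap.range (d n)

end

noncomputable section

/-- Minimal `n`-th syzygy: `IsMinimalSyzygy R n M K` says `K` is the `n`-th syzygy of `M`
computed from a minimal free resolution. -/
def IsMinimalSyzygy (R : Type) [CommRing R] [IsLocalRing R] :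
    ℕ → ModuleCat.{0} R → ModuleCat.{0} R → Prop
  | 0, M, K => Nonempty (K ≃ₗ[R] M)
  | n + 1, M, K => ∃ (m : ℕ) (f : (Fin m → R) →ₗ[R] M),
      Function.Surjective f ∧
      (LinearMap.ker f ≤ (maximalIdeal R) • (⊤ : Submodule R (Fin m → R))) ∧
      IsMinimalSyzygy R n (ModuleCat.of R (LinearMap.ker f)) K

/-- A resolving class of modules: contains `R`, closed under isomorphisms, direct summands,
extensions and syzygies. -/
def IsResolvingClass (R : Type) [CommRing R] (P : ModuleCat.{0} R → Prop) : Prop :=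
  (P (ModuleCat.of R R)) ∧
  (∀ X Y : ModuleCat.{0} R, Nonempty (X ≃ₗ[R] Y) → P X → P Y) ∧
  (∀ (X Y : ModuleCat.{0} R) (i : X →ₗ[R] Y) (r : Y →ₗ[R] X),
      r.comp i = LinearMap.id → P Y → P X) ∧
  (∀ (X Y Z : ModuleCat.{0} R) (f : X →ₗ[R] Y) (g : Y →ₗ[R] Z),
      Function.Injective f → Function.Surjective g → LinearMap.ker g = LinearMap.range f →
      P X → P Z → P Y) ∧
  (∀ (X Y : ModuleCat.{0} R) (m : ℕ) (f : (Fin m → R) →ₗ[R] X), Function.Surjective f →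
      Nonempty (Y ≃ₗ[R] LinearMap.ker f) → P X → P Y)

/-- `N` belongs to the resolving closure `res M`. -/
def InResolvingClosure (R : Type) [CommRing R] (M N : ModuleCat.{0} R) : Prop :=
  ∀ P : ModuleCat.{0} R → Prop, IsResolvingClass R P → P M → P N

/-- `M` has finite G-dimension: it admits a finite resolution by totally reflexive modules. -/
def HasFiniteGDim (R : Type) [CommRing R] (M : Type) [AddCommGroup M] [Module R M] : Prop :=
  ∃ (n : ℕ) (T : ℕ → ModuleCat.{0} R) (d : ∀ i : ℕ, T (i + 1) →ₗ[R] T i) (ε : T 0 →ₗ[R] M),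
    (∀ i, IsTotallyReflexive R (T i)) ∧ Function.Surjective ε ∧
    LinearMap.ker ε = LinearMap.range (d 0) ∧
    (∀ i, LinearMap.ker (d i) = LinearMap.range (d (i + 1))) ∧
    (∀ i > n, Subsingleton (T i))

/-- `ω` is a canonical module of the `d`-dimensional Cohen–Macaulay local ring `R`:
`Ext^i(k, ω)` vanishes for `i ≠ d` and is isomorphic to `k` for `i = d`. -/
def IsCanonicalModule (R : Type) [CommRing R] [IsLocalRing R] (d : ℕ)
    (ω : ModuleCat.{0} R) : Prop :=
  Module.Finite R ω ∧
  (∀ i : ℕ, i ≠ d → Subsingleton (ExtGroup R i (ModuleCat.of R (ResidueField R)) ω)) ∧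
  Nonempty ((ExtGroup R d (ModuleCat.of R (ResidueField R)) ω) ≃ₗ[R] (ResidueField R))

/-- Cohen–Macaulay local ring: depth equals Krull dimension. -/
def IsCohenMacaulayLocalRing (R : Type) [CommRing R] [IsLocalRing R] : Prop :=
  (rdepth R R : WithBot ℕ∞) = ringKrullDim R

end

section ExtVanishing

variable {R : Type} [CommRing R]

lemma subsingleton_extGroup_succ_iff (X Y : ModuleCat.{0} R) (n : ℕ) :
    Subsingleton (ExtGroup R (n + 1) X Y) ↔ Subsingleton (Abelian.Ext X Y (n + 1)) := by
  let P := ProjectiveResolution.of X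
  have h : Subsingleton (ExtGroup R (n + 1) X Y) ↔
      ∀ f : P.complex.X (n + 1) ⟶ Y, P.complex.d (n + 2) (n + 1) ≫ f = 0 →
        ∃ g : P.complex.X n ⟶ Y, P.complex.d (n + 1) n ≫ g = f := by
    rw [← ModuleCat.isZero_iff_subsingleton, ExtGroup,
      (P.isoExt (R := R) (n + 1) Y).isZero_iff, ← HomologicalComplex.exactAt_iff_isZero_homology,
      HomologicalComplex.exactAt_iff' _ n (n + 1) (n + 2) (by simp) (by simp),
      ShortComplex.moduleCat_exact_iff]
    rfl
  rw [h]
  constructor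
  · refine fun h ↦ subsingleton_of_forall_eq 0 fun α ↦ ?_
    obtain ⟨f, hf, rfl⟩ := P.extMk_surjective α (n + 2) rfl
    exact (P.extMk_eq_zero_iff f (n + 2) rfl hf n rfl).2 (h f hf)
  · exact fun _ f hf ↦
      (P.extMk_eq_zero_iff f (n + 2) rfl hf n rfl).1 (Subsingleton.elim _ _)

lemma extEventuallyZero_iff (X Y : ModuleCat.{0} R) :
    ExtEventuallyZero R X Y ↔ ∃ t : ℕ, ∀ i > t, Subsingleton (Abelian.Ext X Y i) := by
  refine exists_congr fun t ↦ forall₂_congr fun i hi ↦ ?_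
  obtain ⟨n, rfl⟩ := Nat.exists_eq_add_one_of_ne_zero (Nat.ne_zero_of_lt hi)
  exact subsingleton_extGroup_succ_iff X Y n

lemma ExtEventuallyZero.of_iso {X X' Y : ModuleCat.{0} R} (e : X ≅ X')
    (h : ExtEventuallyZero R X Y) : ExtEventuallyZero R X' Y := by
  obtain ⟨t, ht⟩ := h
  refine ⟨t, fun i hi ↦ ?_⟩
  have e' : ExtGroup R i X' Y ≅ ExtGroup R i X Y := ((Ext R (ModuleCat.{0} R) i).mapIso e.op).app Y
  have := ht i hi
  exact e'.toLinearEquiv.toEquiv.subsingleton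

lemma extEventuallyZero_congr_of_iso {X X' Y : ModuleCat.{0} R} (e : X ≅ X') :
    ExtEventuallyZero R X Y ↔ ExtEventuallyZero R X' Y :=
  ⟨.of_iso e, .of_iso e.symm⟩

lemma extEventuallyZero_quotSMulTop_iff [IsLocalRing R] [IsNoetherianRing R]
    (M N : ModuleCat.{0} R) [Module.Finite R M] [Module.Finite R N]
    {r : R} (hr : r ∈ maximalIdeal R) (hreg : IsSMulRegular M r) :
    ExtEventuallyZero R M N ↔ ExtEventuallyZero R (ModuleCat.of R (QuotSMulTop r M)) N := by
  have hS := hreg.smulShortComplex_shortExact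
  rw [extEventuallyZero_iff, extEventuallyZero_iff]
  constructor
  · rintro ⟨t, ht⟩
    refine ⟨t + 1, fun i hi ↦ subsingleton_of_forall_eq 0 fun x ↦ ?_⟩
    obtain ⟨j, rfl⟩ := Nat.exists_eq_add_of_lt hi
    have := ht (t + 1 + j + 1) (by omega)
    have := ht (t + j + 1) (by omega)
    obtain ⟨y, rfl⟩ := Abelian.Ext.contravariant_sequence_exact₃ hS N x
      (Subsingleton.elim (α := Abelian.Ext M N _) _ _)
      (show 1 + (t + j + 1) = t + 1 + j + 1 by omega)
    have hy : y = 0 := Subsingleton.elim (α := Abelian.Ext M N _) y 0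
    rw [hy]
    exact Abelian.Ext.comp_zero ..
  · rintro ⟨t, ht⟩
    refine ⟨t, fun i hi ↦ ?_⟩
    have := ht (i + 1) (by omega)
    have hsmul (y : Abelian.Ext M N i) :
        (Abelian.Ext.mk₀ (r • 𝟙 M)).comp y (zero_add i) = r • y := by
      rw [Abelian.Ext.mk₀_smul, Abelian.Ext.smul_comp, Abelian.Ext.mk₀_id_comp]
    have hsurj : ∀ x : Abelian.Ext M N i, ∃ y : Abelian.Ext M N i, r • y = x := fun x ↦ by
      obtain ⟨y, hy⟩ := Abelian.Ext.contravariant_sequence_exact₁ hS N (n₀ := i) x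
        (add_comm 1 i)
        (Subsingleton.elim (α := Abelian.Ext (ModuleCat.of R (QuotSMulTop r M)) N _) _ _)
      exact ⟨y, (hsmul y).symm.trans hy⟩
    by_contra hne
    rw [not_subsingleton_iff_nontrivial] at hne
    refine Submodule.top_ne_pointwise_smul_of_mem_jacobson_annihilator
      (M := Abelian.Ext M N i) (r := r) (maximalIdeal_le_jacobson _ hr) ?_
    refine (eq_top_iff.2 fun x _ ↦ ?_).symm
    obtain ⟨y, rfl⟩ := hsurj x
    exact Submodule.smul_mem_pointwise_smul _ _ _ trivial

end ExtVanishing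

/-- for an `M`-regular sequence `rs` in the maximal ideal,
`Ext(M, N)` vanishes eventually iff `Ext(M/rsM, N)` does. -/
theorem stmt3 (R : Type) [CommRing R] [IsLocalRing R] [IsNoetherianRing R]
    (M N : Type) [AddCommGroup M] [Module R M] [AddCommGroup N] [Module R N]
    (hM : Module.Finite R M) (hN : Module.Finite R N)
    (rs : List R) (hmem : ∀ r ∈ rs, r ∈ maximalIdeal R)
    (hreg : RingTheory.Sequence.IsWeaklyRegular M rs) :
    ExtEventuallyZero R (ModuleCat.of R M) (ModuleCat.of R N) ↔
      ExtEventuallyZero R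
        (ModuleCat.of R (M ⧸ (Ideal.ofList rs • (⊤ : Submodule R M))))
        (ModuleCat.of R N) := by
  induction rs generalizing M with
  | nil =>
    refine extEventuallyZero_congr_of_iso
      (LinearEquiv.toModuleIso (Submodule.quotEquivOfEqBot _ ?_).symm)
    rw [Ideal.ofList_nil, Submodule.bot_smul]
  | cons r rs ih =>
    obtain ⟨hr, hrs⟩ := (RingTheory.Sequence.isWeaklyRegular_cons_iff M r rs).1 hreg
    rw [extEventuallyZero_quotSMulTop_iff (ModuleCat.of R M) (ModuleCat.of R N)
        (hmem r List.mem_cons_self) hr,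
      extEventuallyZero_congr_of_iso
        (Submodule.quotOfListConsSMulTopEquivQuotSMulTopInner M r rs).toModuleIso]
    exact ih (QuotSMulTop r M) inferInstance (fun s hs ↦ hmem s (List.mem_cons_of_mem r hs)) hrs
end

section
/- Let $(R,\mathfrak{m})$ be a commutative noetherian local ring and $x \in \mathfrak{m}$ an $R$-regular element. If $R/(x)$ satisfies property (ee), then so does $R$. -/
open CategoryTheory IsLocalRing

/-- A resolution of a module by finitely generated projective modules. -/
structure FGProjResolution (R : Type) [CommRing R] (M : Type) [AddCommGroup M] [Module R M] where
  X : ℕ → Type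
  [acg : ∀ n, AddCommGroup (X n)]
  [mod : ∀ n, Module R (X n)]
  [fin : ∀ n, Module.Finite R (X n)]
  [proj : ∀ n, Module.Projective R (X n)]
  d : ∀ n : ℕ, X (n + 1) →ₗ[R] X n
  ε : X 0 →ₗ[R] M
  ε_surjective : Function.Surjective ε
  exact_zero : Function.Exact (d 0) ε
  exact_succ : ∀ n, Function.Exact (d (n + 1)) (d n)

namespace FGProjResolution

attribute [instance] acg mod fin proj

variable {R : Type} [CommRing R] {M : Type} [AddCommGroup M] [Module R M]
  (F : FGProjResolution R M) (N : Type) [AddCommGroup N] [Module R N]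

/-- The complex `Hom(F, N)` is exact in degree `n + 1`. -/
def HomExact (n : ℕ) : Prop :=
  ∀ φ : F.X (n + 1) →ₗ[R] N, φ ∘ₗ F.d (n + 1) = 0 → ∃ ψ : F.X n →ₗ[R] N, ψ ∘ₗ F.d n = φ

/-- The underlying chain complex of a resolution. -/
noncomputable def chainComplex : ChainComplex (ModuleCat.{0} R) ℕ :=
  ChainComplex.of (fun n => ModuleCat.of R (F.X n)) (fun n => ModuleCat.ofHom (F.d n))
    (fun n => by
      rw [← ModuleCat.ofHom_comp, (F.exact_succ n).linearMap_comp_eq_zero]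
      rfl)

lemma chainComplex_d (n : ℕ) : F.chainComplex.d (n + 1) n = ModuleCat.ofHom (F.d n) :=
  by simp [chainComplex, ChainComplex.of]

/-- The augmentation of the chain complex of a resolution. -/
noncomputable def augmentation : F.chainComplex ⟶ (ChainComplex.single₀ _).obj (ModuleCat.of R M) :=
  (F.chainComplex.toSingle₀Equiv _).symm ⟨ModuleCat.ofHom F.ε, by
    rw [F.chainComplex_d 0]
    change ModuleCat.ofHom (F.ε ∘ₗ F.d 0) = 0
    rw [F.exact_zero.linearMap_comp_eq_zero]
    rfl⟩

lemma augmentation_f_zero : F.augmentation.f 0 = ModuleCat.ofHom F.ε :=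
  ChainComplex.toSingle₀Equiv_symm_apply_f_zero ..

lemma quasiIso_augmentation : QuasiIso F.augmentation where
  quasiIsoAt m := by
    induction m with
    | zero =>
      rw [ChainComplex.quasiIsoAt₀_iff, ShortComplex.quasiIso_iff_of_zeros' _ rfl rfl rfl]
      constructor
      · rw [ShortComplex.ShortExact.moduleCat_exact_iff_function_exact]
        change Function.Exact (F.chainComplex.d 1 0) (F.augmentation.f 0)
        rw [chainComplex_d, augmentation_f_zero]
        exact F.exact_zero
      · change Epi (F.augmentation.f 0)
        rw [augmentation_f_zero]
        exact (ModuleCat.epi_iff_surjective _).2 F.ε_surjective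
    | succ m _ =>
      rw [quasiIsoAt_iff_exactAt' (hL := ChainComplex.exactAt_succ_single_obj ..),
        HomologicalComplex.exactAt_iff' _ (m + 2) (m + 1) m (by simp) (by simp),
        ShortComplex.ShortExact.moduleCat_exact_iff_function_exact]
      change Function.Exact (F.chainComplex.d (m + 2) (m + 1)) (F.chainComplex.d (m + 1) m)
      rw [chainComplex_d, chainComplex_d]
      exact F.exact_succ m

/-- The resolution as a projective resolution in the category of modules. -/
noncomputable def projectiveResolution : ProjectiveResolution (ModuleCat.of R M) where
  complex := F.chainComplex
  projective n := (IsProjective.iff_projective (F.X n)).1 (F.proj n)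
  π := F.augmentation
  quasiIso := F.quasiIso_augmentation

lemma subsingleton_extGroup_iff (n : ℕ) :
    Subsingleton (ExtGroup R (n + 1) (ModuleCat.of R M) (ModuleCat.of R N)) ↔ F.HomExact N n := by
  rw [← ModuleCat.isZero_iff_subsingleton, ExtGroup,
    (F.projectiveResolution.isoExt (R := R) (n + 1) (ModuleCat.of R N)).isZero_iff,
    ← HomologicalComplex.exactAt_iff_isZero_homology,
    HomologicalComplex.exactAt_iff' _ n (n + 1) (n + 2) (by simp) (by simp),
    ShortComplex.moduleCat_exact_iff]
  change (∀ φ : ModuleCat.of R (F.X (n + 1)) ⟶ ModuleCat.of R N,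
    F.chainComplex.d (n + 2) (n + 1) ≫ φ = 0 →
      ∃ ψ : ModuleCat.of R (F.X n) ⟶ ModuleCat.of R N, F.chainComplex.d (n + 1) n ≫ ψ = φ) ↔ _
  rw [chainComplex_d, chainComplex_d]
  refine ⟨fun h φ hφ => ?_, fun h φ hφ => ?_⟩
  · obtain ⟨ψ, hψ⟩ := h (ModuleCat.ofHom φ) (ModuleCat.hom_ext hφ)
    exact ⟨ψ.hom, congrArg ModuleCat.Hom.hom hψ⟩
  · obtain ⟨ψ, hψ⟩ := h φ.hom (congrArg ModuleCat.Hom.hom hφ)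
    exact ⟨ModuleCat.ofHom ψ, ModuleCat.hom_ext hψ⟩

lemma extEventuallyZero_iff :
    ExtEventuallyZero R (ModuleCat.of R M) (ModuleCat.of R N) ↔
      ∀ᶠ n in Filter.atTop, F.HomExact N n := by
  simp only [Filter.eventually_atTop, ← subsingleton_extGroup_iff]
  refine ⟨fun ⟨t, ht⟩ => ⟨t, fun n hn => ht _ (by omega)⟩, fun ⟨t, ht⟩ => ⟨t, fun n hn => ?_⟩⟩
  obtain ⟨n, rfl⟩ := Nat.exists_eq_succ_of_ne_zero (Nat.ne_zero_of_lt hn)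
  exact ht n (by omega)

end FGProjResolution

open TensorProduct in
lemma LinearMap.baseChange_homExact_iff {R S A B C P : Type*} [CommRing R] [CommRing S]
    [Algebra R S] [AddCommGroup A] [Module R A] [AddCommGroup B] [Module R B]
    [AddCommGroup C] [Module R C] [AddCommGroup P] [Module R P] [Module S P] [IsScalarTower R S P]
    (u : A →ₗ[R] B) (v : B →ₗ[R] C) :
    (∀ φ : S ⊗[R] B →ₗ[S] P, φ ∘ₗ u.baseChange S = 0 →
      ∃ ψ : S ⊗[R] C →ₗ[S] P, ψ ∘ₗ v.baseChange S = φ) ↔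
    (∀ φ : B →ₗ[R] P, φ ∘ₗ u = 0 → ∃ ψ : C →ₗ[R] P, ψ ∘ₗ v = φ) := by
  have key₁ (φ : B →ₗ[R] P) :
      φ.liftBaseChange S ∘ₗ u.baseChange S = (φ ∘ₗ u).liftBaseChange S := by
    ext
    simp
  have key₂ (φ : C →ₗ[R] P) :
      φ.liftBaseChange S ∘ₗ v.baseChange S = (φ ∘ₗ v).liftBaseChange S := by
    ext
    simp
  rw [← (LinearMap.liftBaseChangeEquiv S).toEquiv.forall_congr_right]
  refine forall_congr' fun φ => imp_congr ?_ ?_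
  · change φ.liftBaseChange S ∘ₗ _ = 0 ↔ _
    rw [key₁]
    exact (LinearMap.liftBaseChangeEquiv S).map_eq_zero_iff
  · rw [← (LinearMap.liftBaseChangeEquiv S).toEquiv.exists_congr_right]
    refine exists_congr fun ψ => ?_
    change ψ.liftBaseChange S ∘ₗ _ = φ.liftBaseChange S ↔ _
    rw [key₂]
    exact (LinearMap.liftBaseChangeEquiv S).injective.eq_iff

lemma LinearMap.exists_comp_eq_of_exact {R P A B C : Type*} [CommRing R]
    [AddCommGroup P] [Module R P] [AddCommGroup A] [Module R A] [AddCommGroup B] [Module R B]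
    [AddCommGroup C] [Module R C] {f : A →ₗ[R] B} {g : B →ₗ[R] C} (hf : Function.Injective f)
    (hfg : Function.Exact f g) (θ : P →ₗ[R] B) (hθ : g ∘ₗ θ = 0) :
    ∃ ρ : P →ₗ[R] A, f ∘ₗ ρ = θ := by
  refine ⟨(LinearEquiv.ofInjective f hf).symm ∘ₗ
    θ.codRestrict (LinearMap.range f) fun p => (hfg _).1 (LinearMap.congr_fun hθ p),
    LinearMap.ext fun p => ?_⟩
  exact congrArg Subtype.val ((LinearEquiv.ofInjective f hf).apply_symm_apply _)

namespace FGProjResolution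

variable {R : Type} [CommRing R] {M : Type} [AddCommGroup M] [Module R M]
  (F : FGProjResolution R M)

lemma d_comp_d (n : ℕ) : F.d n ∘ₗ F.d (n + 1) = 0 :=
  (F.exact_succ n).linearMap_comp_eq_zero

section ShortExact

variable {A B C : Type} [AddCommGroup A] [Module R A] [AddCommGroup B] [Module R B]
  [AddCommGroup C] [Module R C] {f : A →ₗ[R] B} {g : B →ₗ[R] C}

lemma homExact_right (hf : Function.Injective f) (hg : Function.Surjective g)
    (hfg : Function.Exact f g) {n : ℕ} (hB : F.HomExact B n) (hA : F.HomExact A (n + 1)) :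
    F.HomExact C n := by
  intro φ hφ
  obtain ⟨φ', rfl⟩ := Module.projective_lifting_property g φ hg
  obtain ⟨χ, hχ⟩ := LinearMap.exists_comp_eq_of_exact hf hfg (φ' ∘ₗ F.d (n + 1)) hφ
  obtain ⟨ψ, rfl⟩ := hA χ ((LinearMap.cancel_left hf).1 (by
    rw [← LinearMap.comp_assoc, hχ, LinearMap.comp_assoc, F.d_comp_d, LinearMap.comp_zero,
      LinearMap.comp_zero]))
  obtain ⟨ρ, hρ⟩ := hB (φ' - f ∘ₗ ψ) (by rw [LinearMap.sub_comp, ← hχ]; exact sub_self _)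
  refine ⟨g ∘ₗ ρ, ?_⟩
  rw [LinearMap.comp_assoc, hρ, LinearMap.comp_sub, ← LinearMap.comp_assoc,
    hfg.linearMap_comp_eq_zero, LinearMap.zero_comp, sub_zero]

lemma homExact_left (hf : Function.Injective f) (hg : Function.Surjective g)
    (hfg : Function.Exact f g) {n : ℕ} (hB : F.HomExact B (n + 1)) (hC : F.HomExact C n) :
    F.HomExact A (n + 1) := by
  intro φ hφ
  obtain ⟨ψ, hψ⟩ := hB (f ∘ₗ φ) (by rw [LinearMap.comp_assoc, hφ, LinearMap.comp_zero])
  obtain ⟨χ, hχ⟩ := hC (g ∘ₗ ψ) (by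
    rw [LinearMap.comp_assoc, hψ, ← LinearMap.comp_assoc, hfg.linearMap_comp_eq_zero,
      LinearMap.zero_comp])
  obtain ⟨χ', rfl⟩ := Module.projective_lifting_property g χ hg
  obtain ⟨ρ, hρ⟩ := LinearMap.exists_comp_eq_of_exact hf hfg (ψ - χ' ∘ₗ F.d n) (by
    rw [LinearMap.comp_sub, ← hχ]; exact sub_self _)
  refine ⟨ρ, (LinearMap.cancel_left hf).1 ?_⟩
  rw [← LinearMap.comp_assoc, hρ, LinearMap.sub_comp, hψ, LinearMap.comp_assoc, F.d_comp_d,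
    LinearMap.comp_zero, sub_zero]

end ShortExact

/-- The first syzygy of the resolved module is resolved by the truncation. -/
def tail : FGProjResolution R (LinearMap.ker F.ε) where
  X n := F.X (n + 1)
  d n := F.d (n + 1)
  ε := (F.d 0).codRestrict _ fun p => F.exact_zero.apply_apply_eq_zero p
  ε_surjective := fun ⟨y, hy⟩ => by
    obtain ⟨z, hz⟩ := (F.exact_zero y).1 hy
    exact ⟨z, Subtype.ext hz⟩
  exact_zero := fun y => by
    rw [← F.exact_succ 0 y, Subtype.ext_iff]
    rfl
  exact_succ n := F.exact_succ (n + 1)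

section Existence

variable [IsNoetherianRing R]

/-- The kernel of a chosen surjection from a finite free module. -/
noncomputable def syzygyModule (K : {K : ModuleCat.{0} R // Module.Finite R K}) :
    {K : ModuleCat.{0} R // Module.Finite R K} :=
  haveI := K.2
  ⟨ModuleCat.of R (LinearMap.ker (Module.Finite.exists_fin' R K.1).choose_spec.choose),
    inferInstanceAs (Module.Finite R (LinearMap.ker _))⟩

variable (R M) in
lemma nonempty_of_finite [Module.Finite R M] : Nonempty (FGProjResolution R M) := by
  let K : ℕ → {K : ModuleCat.{0} R // Module.Finite R K} :=
    fun n => Nat.rec ⟨ModuleCat.of R M, ‹_›⟩ (fun _ => syzygyModule) n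
  have hK := fun n => (K n).2
  let k : ℕ → ℕ := fun n => (Module.Finite.exists_fin' R (K n).1).choose
  let p : ∀ n, (Fin (k n) → R) →ₗ[R] (K n).1 :=
    fun n => (Module.Finite.exists_fin' R (K n).1).choose_spec.choose
  have hp : ∀ n, Function.Surjective (p n) :=
    fun n => (Module.Finite.exists_fin' R (K n).1).choose_spec.choose_spec
  let i : ∀ n, (K (n + 1)).1 →ₗ[R] (Fin (k n) → R) := fun n => (LinearMap.ker (p n)).subtype
  have hi : ∀ n, Function.Injective (i n) := fun n => Subtype.val_injective
  have hip : ∀ n, Function.Exact (i n) (p n) := fun n => LinearMap.exact_subtype_ker_map _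
  exact ⟨{
    X := fun n => Fin (k n) → R
    d := fun n => i n ∘ₗ p (n + 1)
    ε := p 0
    ε_surjective := hp 0
    exact_zero := (hp 1).comp_exact_iff_exact.2 (hip 0)
    exact_succ := fun n => (hp (n + 2)).comp_exact_iff_exact.2
      ((hi n).comp_exact_iff_exact.2 (hip (n + 1))) }⟩

end Existence

section BaseChange
open TensorProduct

variable (x : R)

lemma exists_eq_one_tmul (t : (R ⧸ Ideal.span {x}) ⊗[R] M) :
    ∃ m : M, (1 : R ⧸ Ideal.span {x}) ⊗ₜ[R] m = t :=
  TensorProduct.mk_surjective R M _ Ideal.Quotient.mk_surjective t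

lemma one_tmul_eq_zero_iff (m : M) :
    (1 : R ⧸ Ideal.span {x}) ⊗ₜ[R] m = 0 ↔ ∃ m' : M, x • m' = m := by
  rw [← (TensorProduct.quotTensorEquivQuotSMul M (Ideal.span {x})).map_eq_zero_iff,
    TensorProduct.quotTensorEquivQuotSMul_mk_one_tmul, Submodule.Quotient.mk_eq_zero,
    Submodule.ideal_span_singleton_smul, Submodule.mem_smul_pointwise_iff_exists]
  simp

lemma exact_baseChange {A B C D : Type} [AddCommGroup A] [Module R A]
    [AddCommGroup B] [Module R B] [AddCommGroup C] [Module R C] [AddCommGroup D] [Module R D]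
    {f : A →ₗ[R] B} {g : B →ₗ[R] C} {h : C →ₗ[R] D} (hfg : Function.Exact f g)
    (hgh : Function.Exact g h) (hD : IsSMulRegular D x) :
    Function.Exact (f.baseChange (R ⧸ Ideal.span {x})) (g.baseChange (R ⧸ Ideal.span {x})) := by
  intro t
  obtain ⟨b, rfl⟩ := exists_eq_one_tmul x t
  rw [LinearMap.baseChange_tmul, one_tmul_eq_zero_iff]
  constructor
  · rintro ⟨c, hc⟩
    obtain ⟨b', rfl⟩ := (hgh c).1 (hD (by
      simp only [← map_smul, hc, hgh.apply_apply_eq_zero, smul_zero]))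
    obtain ⟨a, ha⟩ := (hfg (b - x • b')).1 (by rw [map_sub, map_smul, hc, sub_self])
    refine ⟨1 ⊗ₜ a, ?_⟩
    rw [LinearMap.baseChange_tmul, ha, TensorProduct.tmul_sub, sub_eq_self,
      one_tmul_eq_zero_iff]
    exact ⟨b', rfl⟩
  · rintro ⟨s, hs⟩
    obtain ⟨a, rfl⟩ := exists_eq_one_tmul x s
    rw [LinearMap.baseChange_tmul, ← sub_eq_zero, ← TensorProduct.tmul_sub,
      one_tmul_eq_zero_iff] at hs
    obtain ⟨b', hb'⟩ := hs
    refine ⟨-g b', ?_⟩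
    rw [smul_neg, ← map_smul, hb', map_sub, hfg.apply_apply_eq_zero, zero_sub, neg_neg]

/-- The reduction of a resolution modulo an element regular on the ring and the module. -/
noncomputable def quotient (hR : x ∈ nonZeroDivisors R) (hM : IsSMulRegular M x) :
    FGProjResolution (R ⧸ Ideal.span {x}) ((R ⧸ Ideal.span {x}) ⊗[R] M) where
  X n := (R ⧸ Ideal.span {x}) ⊗[R] F.X n
  d n := (F.d n).baseChange _
  ε := F.ε.baseChange _
  ε_surjective := LinearMap.lTensor_surjective _ F.ε_surjective
  exact_zero := lTensor_exact _ F.exact_zero F.ε_surjective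
  exact_succ
    | 0 => exact_baseChange x (F.exact_succ 0) F.exact_zero hM
    | n + 1 => exact_baseChange x (F.exact_succ (n + 1)) (F.exact_succ n)
        (Module.Flat.isSMulRegular_of_nonZeroDivisors hR)

lemma quotient_homExact_iff (hR : x ∈ nonZeroDivisors R) (hM : IsSMulRegular M x)
    (P : Type) [AddCommGroup P] [Module R P] [Module (R ⧸ Ideal.span {x}) P]
    [IsScalarTower R (R ⧸ Ideal.span {x}) P] (n : ℕ) :
    (F.quotient x hR hM).HomExact P n ↔ F.HomExact P n :=
  LinearMap.baseChange_homExact_iff _ _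

end BaseChange

end FGProjResolution

namespace FGProjResolution

open TensorProduct Filter

section Quotient

variable {R : Type} [CommRing R] {M : Type} [AddCommGroup M] [Module R M]
  (F : FGProjResolution R M) {N : Type} [AddCommGroup N] [Module R N] {x : R}

lemma exact_smul_mk (N : Type) [AddCommGroup N] [Module R N] (x : R) :
    Function.Exact (LinearMap.lsmul R N x) (TensorProduct.mk R (R ⧸ Ideal.span {x}) N 1) :=
  one_tmul_eq_zero_iff x

lemma mk_one_surjective (N : Type) [AddCommGroup N] [Module R N] (x : R) :
    Function.Surjective (TensorProduct.mk R (R ⧸ Ideal.span {x}) N 1) :=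
  exists_eq_one_tmul x

lemma homExact_of_homExact_quotient [IsNoetherianRing R] [IsLocalRing R] [Module.Finite R N]
    (hx : x ∈ maximalIdeal R) (hN : IsSMulRegular N x) {n : ℕ}
    (h : F.HomExact ((R ⧸ Ideal.span {x}) ⊗[R] N) n) : F.HomExact N n := by
  have hle : LinearMap.ker (LinearMap.lcomp R N (F.d (n + 1))) ≤
      LinearMap.range (LinearMap.lcomp R N (F.d n)) := by
    refine Submodule.le_of_le_smul_of_le_jacobson_bot (I := maximalIdeal R)
      (IsNoetherian.noetherian _) (jacobson_eq_maximalIdeal ⊥ bot_ne_top).ge fun φ hφ => ?_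
    replace hφ : φ ∘ₗ F.d (n + 1) = 0 := hφ
    have hN : Function.Injective (LinearMap.lsmul R N x) := hN
    obtain ⟨ψ, hψ⟩ := h (TensorProduct.mk R (R ⧸ Ideal.span {x}) N 1 ∘ₗ φ) (by
      rw [LinearMap.comp_assoc, hφ, LinearMap.comp_zero])
    obtain ⟨ψ, rfl⟩ := Module.projective_lifting_property _ ψ (mk_one_surjective N x)
    obtain ⟨χ, hχ⟩ := LinearMap.exists_comp_eq_of_exact hN (exact_smul_mk N x)
      (φ - ψ ∘ₗ F.d n) (by
        ext p
        have hp := LinearMap.congr_fun hψ p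
        simp only [LinearMap.comp_apply] at hp
        simp [-TensorProduct.mk_apply, hp])
    have hχ' : χ ∘ₗ F.d (n + 1) = 0 := (LinearMap.cancel_left hN).1 (by
      rw [← LinearMap.comp_assoc, hχ, LinearMap.sub_comp, hφ, LinearMap.comp_assoc, F.d_comp_d,
        LinearMap.comp_zero, LinearMap.comp_zero, sub_zero])
    rw [← add_sub_cancel (ψ ∘ₗ F.d n) φ, ← hχ]
    exact Submodule.add_mem_sup ⟨ψ, rfl⟩ (Submodule.smul_mem_smul hx hχ')
  exact fun φ hφ => hle hφ

lemma eventually_homExact_quotient_iff [IsNoetherianRing R] [IsLocalRing R] [Module.Finite R N]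
    (hx : x ∈ maximalIdeal R) (hN : IsSMulRegular N x) :
    (∀ᶠ n in atTop, F.HomExact ((R ⧸ Ideal.span {x}) ⊗[R] N) n) ↔
      ∀ᶠ n in atTop, F.HomExact N n := by
  refine ⟨fun h => h.mono fun _ => F.homExact_of_homExact_quotient hx hN, fun h => ?_⟩
  filter_upwards [h, (tendsto_add_atTop_nat 1).eventually h] with n h₁ h₂
  exact F.homExact_right (f := LinearMap.lsmul R N x) hN (mk_one_surjective N x)
    (exact_smul_mk N x) h₁ h₂

end Quotient

end FGProjResolution

section ExtVanishing

open TensorProduct Filter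

variable {R : Type} [CommRing R] [IsNoetherianRing R]
  {M : Type} [AddCommGroup M] [Module R M] [Module.Finite R M]
  {N : Type} [AddCommGroup N] [Module R N]

lemma extEventuallyZero_quotient_iff [IsLocalRing R] [Module.Finite R N]
    {x : R} (hx : x ∈ maximalIdeal R) (hR : x ∈ nonZeroDivisors R)
    (hM : IsSMulRegular M x) (hN : IsSMulRegular N x) :
    ExtEventuallyZero (R ⧸ Ideal.span {x})
      (ModuleCat.of (R ⧸ Ideal.span {x}) ((R ⧸ Ideal.span {x}) ⊗[R] M))
      (ModuleCat.of (R ⧸ Ideal.span {x}) ((R ⧸ Ideal.span {x}) ⊗[R] N)) ↔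
    ExtEventuallyZero R (ModuleCat.of R M) (ModuleCat.of R N) := by
  obtain ⟨F⟩ := FGProjResolution.nonempty_of_finite R M
  rw [(F.quotient x hR hM).extEventuallyZero_iff, F.extEventuallyZero_iff,
    ← F.eventually_homExact_quotient_iff hx hN]
  exact eventually_congr (.of_forall (F.quotient_homExact_iff x hR hM _))

omit [IsNoetherianRing R] [Module.Finite R M] in
lemma FGProjResolution.extEventuallyZero_tail_iff (F : FGProjResolution R M) :
    ExtEventuallyZero R (ModuleCat.of R (LinearMap.ker F.ε)) (ModuleCat.of R N) ↔
      ExtEventuallyZero R (ModuleCat.of R M) (ModuleCat.of R N) := by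
  rw [F.tail.extEventuallyZero_iff, F.extEventuallyZero_iff]
  conv_rhs => rw [← map_add_atTop_eq_nat 1, eventually_map]
  rfl

lemma extEventuallyZero_iff_of_exact {A B C : Type} [AddCommGroup A] [Module R A]
    [AddCommGroup B] [Module R B] [AddCommGroup C] [Module R C] {f : A →ₗ[R] B} {g : B →ₗ[R] C}
    (hf : Function.Injective f) (hg : Function.Surjective g) (hfg : Function.Exact f g)
    (hB : ExtEventuallyZero R (ModuleCat.of R M) (ModuleCat.of R B)) :
    ExtEventuallyZero R (ModuleCat.of R M) (ModuleCat.of R A) ↔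
      ExtEventuallyZero R (ModuleCat.of R M) (ModuleCat.of R C) := by
  obtain ⟨F⟩ := FGProjResolution.nonempty_of_finite R M
  rw [F.extEventuallyZero_iff] at hB ⊢
  rw [F.extEventuallyZero_iff]
  constructor
  · intro hA
    filter_upwards [hB, (tendsto_add_atTop_nat 1).eventually hA] with n h₁ h₂
    exact F.homExact_right hf hg hfg h₁ h₂
  · intro hC
    rw [← map_add_atTop_eq_nat 1, eventually_map]
    filter_upwards [(tendsto_add_atTop_nat 1).eventually hB, hC] with n h₁ h₂
    exact F.homExact_left hf hg hfg h₁ h₂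

omit [IsNoetherianRing R] [Module.Finite R M] in
lemma extEventuallyZero_of_projective [Module.Projective R M] :
    ExtEventuallyZero R (ModuleCat.of R M) (ModuleCat.of R N) := by
  refine ⟨0, fun i hi => ?_⟩
  obtain ⟨i, rfl⟩ := Nat.exists_eq_succ_of_ne_zero hi.ne'
  have : Projective (ModuleCat.of R M) := (IsProjective.iff_projective M).1 ‹_›
  exact ModuleCat.isZero_iff_subsingleton.1 (isZero_Ext_succ_of_projective _ _ i)

end ExtVanishing

/-- if `R/(x)` satisfies (ee) for a regular element `x ∈ 𝔪`, so does `R`. -/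
theorem stmt6 (R : Type) [CommRing R] [IsLocalRing R] [IsNoetherianRing R]
    (x : R) (hx : x ∈ maximalIdeal R) (hreg : x ∈ nonZeroDivisors R)
    (h : PropEE (R ⧸ Ideal.span {x})) : PropEE R := by
  have ee_of_regular : ∀ (M N : Type) [AddCommGroup M] [Module R M] [Module.Finite R M]
      [AddCommGroup N] [Module R N] [Module.Finite R N],
      IsSMulRegular M x → IsSMulRegular N x →
      ExtEventuallyZero R (ModuleCat.of R M) (ModuleCat.of R N) →
      ExtEventuallyZero R (ModuleCat.of R N) (ModuleCat.of R M) := by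
    intro M N _ _ _ _ _ _ hM hN hMN
    rw [← extEventuallyZero_quotient_iff hx hreg hN hM]
    exact h _ _ (Module.Finite.base_change _ _ _) (Module.Finite.base_change _ _ _)
      ((extEventuallyZero_quotient_iff hx hreg hM hN).2 hMN)
  have regular_ker {M : Type} [AddCommGroup M] [Module R M] (F : FGProjResolution R M) :
      IsSMulRegular (LinearMap.ker F.ε) x :=
    (Module.Flat.isSMulRegular_of_nonZeroDivisors hreg).submodule _ _
  have ext_projective : ∀ (M P : Type) [AddCommGroup M] [Module R M] [Module.Finite R M]
      [AddCommGroup P] [Module R P] [Module.Finite R P] [Module.Projective R P],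
      ExtEventuallyZero R (ModuleCat.of R M) (ModuleCat.of R P) := by
    intro M P _ _ _ _ _ _ _
    obtain ⟨F⟩ := FGProjResolution.nonempty_of_finite R M
    exact F.extEventuallyZero_tail_iff.1 (ee_of_regular P _
      (Module.Flat.isSMulRegular_of_nonZeroDivisors hreg) (regular_ker F)
      extEventuallyZero_of_projective)
  have ext_syzygy_iff (M : Type) [AddCommGroup M] [Module R M] [Module.Finite R M]
      {N : Type} [AddCommGroup N] [Module R N] (G : FGProjResolution R N) :
      ExtEventuallyZero R (ModuleCat.of R M) (ModuleCat.of R (LinearMap.ker G.ε)) ↔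
        ExtEventuallyZero R (ModuleCat.of R M) (ModuleCat.of R N) :=
    extEventuallyZero_iff_of_exact Subtype.val_injective G.ε_surjective
      (LinearMap.exact_subtype_ker_map G.ε) (ext_projective M (G.X 0))
  intro M N _ _ hMN
  obtain ⟨F⟩ := FGProjResolution.nonempty_of_finite R M
  obtain ⟨G⟩ := FGProjResolution.nonempty_of_finite R N
  have hsyz := ee_of_regular _ _ (regular_ker F) (regular_ker G)
    ((ext_syzygy_iff _ G).2 (F.extEventuallyZero_tail_iff.2 hMN))
  exact G.extEventuallyZero_tail_iff.1 ((ext_syzygy_iff _ F).1 hsyz)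
end

section
/- Let $R \to S$ be a flat local homomorphism of commutative noetherian local rings. If $S$ satisfies property (tr) (every finitely generated $S$-module $M$ with $\operatorname{Ext}_S^i(M,S)=0$ for all $i>0$ is totally reflexive), then $R$ satisfies property (tr). -/
open CategoryTheory IsLocalRing

open TensorProduct

/-- A resolution of `M` by finitely generated projective modules, with its augmentation `ε`. -/
structure FGProjResolution_s7 (R : Type) [CommRing R] (M : Type) [AddCommGroup M] [Module R M] where
  X : ℕ → Type
  [acg : ∀ n, AddCommGroup (X n)]
  [mod : ∀ n, Module R (X n)]
  [fin : ∀ n, Module.Finite R (X n)]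
  [proj : ∀ n, Module.Projective R (X n)]
  d : ∀ n : ℕ, X (n + 1) →ₗ[R] X n
  ε : X 0 →ₗ[R] M
  surjective_ε : Function.Surjective ε
  exact_zero : Function.Exact (d 0) ε
  exact_succ : ∀ n, Function.Exact (d (n + 1)) (d n)

attribute [instance] FGProjResolution_s7.acg FGProjResolution_s7.mod FGProjResolution_s7.fin
  FGProjResolution_s7.proj

namespace FGProjResolution_s7

/-- A finitely generated module over a noetherian ring has a resolution by finitely generated
projective modules. -/
theorem exists_of_finite (R : Type) [CommRing R] [IsNoetherianRing R] (M : Type)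
    [AddCommGroup M] [Module R M] [Module.Finite R M] : Nonempty (FGProjResolution_s7 R M) := by
  have key (s : Σ k : ℕ, Submodule R (Fin k → R)) :
      ∃ (t : Σ k : ℕ, Submodule R (Fin k → R)) (f : (Fin t.1 → R) →ₗ[R] (Fin s.1 → R)),
        LinearMap.range f = s.2 ∧ LinearMap.ker f = t.2 := by
    obtain ⟨k, f, hf⟩ := Module.Finite.exists_fin' R s.2
    refine ⟨⟨k, LinearMap.ker (s.2.subtype ∘ₗ f)⟩, s.2.subtype ∘ₗ f, ?_, rfl⟩
    rw [LinearMap.range_comp, LinearMap.range_eq_top.2 hf, Submodule.map_top,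
      Submodule.range_subtype]
  choose next f hrange hker using key
  obtain ⟨k, ε, hε⟩ := Module.Finite.exists_fin' R M
  let s (n : ℕ) : Σ k : ℕ, Submodule R (Fin k → R) :=
    Nat.rec ⟨k, LinearMap.ker ε⟩ (fun _ t ↦ next t) n
  exact ⟨{
    X := fun n ↦ Fin (s n).1 → R
    d := fun n ↦ f (s n)
    ε := ε
    surjective_ε := hε
    exact_zero := LinearMap.exact_iff.2 (hrange (s 0)).symm
    exact_succ := fun n ↦ LinearMap.exact_iff.2 ((hker (s n)).trans (hrange (s (n + 1))).symm) }⟩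

variable {R : Type} [CommRing R] {M : Type} [AddCommGroup M] [Module R M]

/-- The underlying chain complex in the category of modules. -/
noncomputable def complex (P : FGProjResolution_s7 R M) : ChainComplex (ModuleCat.{0} R) ℕ :=
  ChainComplex.of (fun n ↦ ModuleCat.of R (P.X n)) (fun n ↦ ModuleCat.ofHom (P.d n))
    (fun n ↦ by
      ext x
      exact (P.exact_succ n).apply_apply_eq_zero x)

theorem complex_d (P : FGProjResolution_s7 R M) (n : ℕ) :
    P.complex.d (n + 1) n = ModuleCat.ofHom (P.d n) :=
  by simp [complex]

theorem complex_d_comp_ε (P : FGProjResolution_s7 R M) :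
    P.complex.d 1 0 ≫ ModuleCat.ofHom P.ε = 0 := by
  rw [complex_d]
  ext x
  exact P.exact_zero.apply_apply_eq_zero x

/-- The associated projective resolution in the category of modules. -/
noncomputable def toProjectiveResolution (P : FGProjResolution_s7 R M) :
    ProjectiveResolution (ModuleCat.of R M) where
  complex := P.complex
  projective n := (IsProjective.iff_projective (P.X n)).1 (P.proj n)
  π := (ChainComplex.toSingle₀Equiv _ _).symm ⟨ModuleCat.ofHom P.ε, P.complex_d_comp_ε⟩
  quasiIso := ⟨fun n ↦ by
    cases n with
    | zero =>
      rw [ChainComplex.quasiIsoAt₀_iff, ShortComplex.quasiIso_iff_of_zeros']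
      · refine (ShortComplex.exact_and_epi_g_iff_of_iso
          (S₂ := ShortComplex.mk (ModuleCat.ofHom (P.d 0)) (ModuleCat.ofHom P.ε) (by
            ext x
            exact P.exact_zero.apply_apply_eq_zero x)) ?_).2
          ⟨(ShortComplex.ShortExact.moduleCat_exact_iff_function_exact _).2 P.exact_zero,
            (ModuleCat.epi_iff_surjective _).2 P.surjective_ε⟩
        exact ShortComplex.isoMk (Iso.refl _) (Iso.refl _) (Iso.refl _)
          ((Category.id_comp _).trans ((P.complex_d 0).symm.trans (Category.comp_id _).symm))
          ((Category.id_comp _).trans (.trans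
            (ChainComplex.toSingle₀Equiv_symm_apply_f_zero (C := P.complex) (ModuleCat.ofHom P.ε)
              P.complex_d_comp_ε).symm
            (Category.comp_id _).symm))
      all_goals rfl
    | succ n =>
      rw [quasiIsoAt_iff_exactAt']
      · rw [HomologicalComplex.exactAt_iff' _ (n + 1 + 1) (n + 1) n (by simp) (by simp),
          ShortComplex.ShortExact.moduleCat_exact_iff_function_exact]
        dsimp [HomologicalComplex.sc', HomologicalComplex.shortComplexFunctor']
        rw [complex_d, complex_d]
        exact P.exact_succ n
      · apply ChainComplex.exactAt_succ_single_obj⟩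

theorem dualMap_comp_homLinearEquiv (P : FGProjResolution_s7 R M) (n : ℕ) :
    (P.d n).dualMap ∘ₗ (ModuleCat.homLinearEquiv (S := R)).toLinearMap =
      (ModuleCat.homLinearEquiv (S := R)).toLinearMap ∘ₗ
        ((P.complex.linearYonedaObj R (ModuleCat.of R R)).d n (n + 1)).hom := by
  rw [ChainComplex.linearYonedaObj_d, complex_d]
  rfl

/-- `Ext^{n+1}(M, R)` vanishes iff the dual of a resolution of `M` is exact in degree `n + 1`. -/
theorem subsingleton_extGroup_succ_iff (P : FGProjResolution_s7 R M) (n : ℕ) :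
    Subsingleton (ExtGroup R (n + 1) (ModuleCat.of R M) (ModuleCat.of R R)) ↔
      Function.Exact (P.d n).dualMap (P.d (n + 1)).dualMap := by
  rw [← ModuleCat.isZero_iff_subsingleton, ExtGroup,
    (P.toProjectiveResolution.isoExt (n + 1) (ModuleCat.of R R)).isZero_iff,
    ← HomologicalComplex.exactAt_iff_isZero_homology,
    HomologicalComplex.exactAt_iff' _ n (n + 1) (n + 1 + 1) (by simp) (by simp),
    ShortComplex.ShortExact.moduleCat_exact_iff_function_exact]
  exact (Function.Exact.iff_of_ladder_linearEquiv (P.dualMap_comp_homLinearEquiv n)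
    (P.dualMap_comp_homLinearEquiv (n + 1))).symm

end FGProjResolution_s7

namespace Module.Dual

variable (R S : Type) [CommRing R] [CommRing S] [Algebra R S]
  (M : Type) [AddCommGroup M] [Module R M]

theorem isBaseChange_baseChange [Module.Flat R S] [Module.FinitePresentation R M] :
    IsBaseChange S (Module.Dual.baseChange (R := R) (V := M) S) := by
  refine IsBaseChange.of_equiv ((Module.FinitePresentation.isBaseChange_map R M R S).equiv ≪≫ₗ
    LinearEquiv.congrRight (AlgebraTensorModule.rid R S S)) fun f ↦ ?_
  ext
  simp [IsBaseChange.equiv_tmul, LinearEquiv.congrRight]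

/-- Dualizing commutes with flat base change for finitely presented modules. -/
noncomputable def tensorEquiv [Module.Flat R S] [Module.FinitePresentation R M] :
    S ⊗[R] Module.Dual R M ≃ₗ[S] Module.Dual S (S ⊗[R] M) :=
  (isBaseChange_baseChange R S M).equiv

variable {R S M}

@[simp]
theorem tensorEquiv_tmul_tmul [Module.Flat R S] [Module.FinitePresentation R M] (s t : S)
    (f : Module.Dual R M) (m : M) : tensorEquiv R S M (s ⊗ₜ f) (t ⊗ₜ m) = s * (f m • t) := by
  simp [tensorEquiv, IsBaseChange.equiv_tmul]

theorem tensorEquiv_baseChange_dualMap [Module.Flat R S] [Module.FinitePresentation R M]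
    {N : Type} [AddCommGroup N] [Module R N] [Module.FinitePresentation R N] (g : M →ₗ[R] N) :
    (g.baseChange S).dualMap ∘ₗ (tensorEquiv R S N).toLinearMap =
      (tensorEquiv R S M).toLinearMap ∘ₗ g.dualMap.baseChange S := by
  ext f m
  simp

theorem bijective_eval_iff_baseChange [Module.FaithfullyFlat R S] [Module.FinitePresentation R M]
    [Module.FinitePresentation R (Module.Dual R M)] :
    Function.Bijective (Module.Dual.eval S (S ⊗[R] M)) ↔
      Function.Bijective (Module.Dual.eval R M) := by
  have h : (tensorEquiv R S M).toLinearMap.dualMap ∘ₗ Module.Dual.eval S (S ⊗[R] M) =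
      (tensorEquiv R S (Module.Dual R M)).toLinearMap ∘ₗ (Module.Dual.eval R M).baseChange S := by
    ext m f
    simp
  rw [← Module.FaithfullyFlat.lTensor_bijective_iff_bijective R S]
  have h₁ := Function.Bijective.of_comp_iff' (tensorEquiv R S M).dualMap.bijective
    (Module.Dual.eval S (S ⊗[R] M))
  have h₂ := Function.Bijective.of_comp_iff' (tensorEquiv R S (Module.Dual R M)).bijective
    ((Module.Dual.eval R M).baseChange S)
  exact h₁.symm.trans ((iff_of_eq (congrArg Function.Bijective (congrArg DFunLike.coe h))).trans h₂)

end Module.Dual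

namespace FGProjResolution_s7

variable {R : Type} [CommRing R] {M : Type} [AddCommGroup M] [Module R M]

/-- Base change of a resolution along a flat ring map. -/
noncomputable def baseChange (P : FGProjResolution_s7 R M) (S : Type) [CommRing S] [Algebra R S]
    [Module.Flat R S] : FGProjResolution_s7 S (S ⊗[R] M) where
  X n := S ⊗[R] P.X n
  d n := (P.d n).baseChange S
  ε := P.ε.baseChange S
  surjective_ε := LinearMap.lTensor_surjective S P.surjective_ε
  exact_zero := Module.Flat.lTensor_exact S P.exact_zero
  exact_succ n := Module.Flat.lTensor_exact S (P.exact_succ n)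

theorem exact_dualMap_baseChange_iff (P : FGProjResolution_s7 R M) (S : Type) [CommRing S]
    [Algebra R S] [Module.FaithfullyFlat R S] (n : ℕ) :
    Function.Exact ((P.baseChange S).d n).dualMap ((P.baseChange S).d (n + 1)).dualMap ↔
      Function.Exact (P.d n).dualMap (P.d (n + 1)).dualMap := by
  have (n : ℕ) := Module.finitePresentation_of_projective R (P.X n)
  rw [← Module.FaithfullyFlat.lTensor_exact_iff_exact R S]
  exact Function.Exact.iff_of_ladder_linearEquiv
    (Module.Dual.tensorEquiv_baseChange_dualMap (S := S) (P.d n))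
    (Module.Dual.tensorEquiv_baseChange_dualMap (S := S) (P.d (n + 1)))

end FGProjResolution_s7

theorem subsingleton_extGroup_congr {R : Type} [CommRing R] {M N : Type} [AddCommGroup M]
    [Module R M] [AddCommGroup N] [Module R N] (e : M ≃ₗ[R] N) (i : ℕ) (L : ModuleCat.{0} R) :
    Subsingleton (ExtGroup R i (ModuleCat.of R M) L) ↔
      Subsingleton (ExtGroup R i (ModuleCat.of R N) L) := by
  rw [← ModuleCat.isZero_iff_subsingleton, ← ModuleCat.isZero_iff_subsingleton]
  exact (((Ext R (ModuleCat.{0} R) i).mapIso e.toModuleIso.symm.op).app L).isZero_iff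

/-- Vanishing of `Ext(M, R)` is invariant under faithfully flat base change. -/
theorem subsingleton_extGroup_baseChange_iff {R S : Type} [CommRing R] [IsNoetherianRing R]
    [CommRing S] [Algebra R S] [Module.FaithfullyFlat R S] (M : Type) [AddCommGroup M] [Module R M]
    [Module.Finite R M] {i : ℕ} (hi : 0 < i) :
    Subsingleton (ExtGroup S i (ModuleCat.of S (S ⊗[R] M)) (ModuleCat.of S S)) ↔
      Subsingleton (ExtGroup R i (ModuleCat.of R M) (ModuleCat.of R R)) := by
  obtain ⟨n, rfl⟩ := Nat.exists_eq_succ_of_ne_zero hi.ne'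
  obtain ⟨P⟩ := FGProjResolution_s7.exists_of_finite R M
  exact ((P.baseChange S).subsingleton_extGroup_succ_iff n).trans
    ((P.exact_dualMap_baseChange_iff S n).trans (P.subsingleton_extGroup_succ_iff n).symm)

/-- property (tr) descends along a flat local homomorphism. -/
theorem stmt7 (R S : Type) [CommRing R] [IsLocalRing R] [IsNoetherianRing R]
    [CommRing S] [IsLocalRing S] [IsNoetherianRing S]
    [Algebra R S] [Module.Flat R S] [IsLocalHom (algebraMap R S)]
    (h : PropTR S) : PropTR R := by
  have : Module.FaithfullyFlat R S := Module.FaithfullyFlat.of_flat_of_isLocalHom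
  intro M _ _ _ hM
  have := Module.finitePresentation_of_finite R M
  have := Module.finitePresentation_of_finite R (Module.Dual R M)
  obtain ⟨-, hrefl, -, hdual⟩ := h (S ⊗[R] M) inferInstance fun i hi ↦
    (subsingleton_extGroup_baseChange_iff M hi).2 (hM i hi)
  exact ⟨inferInstance, Module.Dual.bijective_eval_iff_baseChange.1 hrefl, hM, fun i hi ↦
    (subsingleton_extGroup_baseChange_iff (S := S) _ hi).1
      ((subsingleton_extGroup_congr (Module.Dual.tensorEquiv R S M) i _).2 (hdual i hi))⟩
end

section
/- Let $(R,\mathfrak{m})$ be a commutative noetherian local ring and $x \in \mathfrak{m}$ an $R$-regular element. Then $R$ satisfies property (tr) if and only if $R/(x)$ satisfies property (tr). -/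
open CategoryTheory IsLocalRing

/-- Both constructions of `Ext` vanish in positive degrees simultaneously: each is computed by a
projective resolution of the first argument. -/
lemma subsingleton_extGroup_succ_iff_s8 (A : Type) [CommRing A] (n : ℕ) (M N : ModuleCat.{0} A) :
    Subsingleton (ExtGroup A (n + 1) M N) ↔ Subsingleton (Abelian.Ext.{0} M N (n + 1)) := by
  let P := projectiveResolution M
  have h1 : Subsingleton (ExtGroup A (n + 1) M N) ↔
      ∀ f : P.complex.X (n + 1) ⟶ N, P.complex.d (n + 2) (n + 1) ≫ f = 0 →
        ∃ g : P.complex.X n ⟶ N, P.complex.d (n + 1) n ≫ g = f := by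
    rw [ExtGroup, ← ModuleCat.isZero_iff_subsingleton, (P.isoExt (n + 1) N).isZero_iff,
      ← HomologicalComplex.exactAt_iff_isZero_homology,
      HomologicalComplex.exactAt_iff' _ n (n + 1) (n + 2) (by simp) (by simp),
      ShortComplex.moduleCat_exact_iff]
    rfl
  rw [h1]
  constructor
  · intro h
    refine ⟨fun a b ↦ ?_⟩
    suffices H : ∀ a : Abelian.Ext.{0} M N (n + 1), a = 0 by rw [H a, H b]
    intro a
    obtain ⟨f, hf, rfl⟩ := P.extMk_surjective a (n + 2) rfl
    exact (P.extMk_eq_zero_iff f (n + 2) rfl hf n rfl).2 (h f hf)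
  · intro h f hf
    exact (P.extMk_eq_zero_iff f (n + 2) rfl hf n rfl).1 (Subsingleton.elim _ _)

/-- `Ext_A^n(M, A) = 0`. -/
def ExtVanishes (A : Type) [CommRing A] (n : ℕ) (M : Type) [AddCommGroup M] [Module A M] : Prop :=
  Subsingleton (Abelian.Ext.{0} (ModuleCat.of A M) (ModuleCat.of A A) n)

section ExtVanishes

variable {A : Type} [CommRing A] {X Y Z : Type} [AddCommGroup X] [Module A X]
  [AddCommGroup Y] [Module A Y] [AddCommGroup Z] [Module A Z]

lemma forall_extGroup_iff :
    (∀ i > 0, Subsingleton (ExtGroup A i (ModuleCat.of A X) (ModuleCat.of A A))) ↔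
      ∀ n, ExtVanishes A (n + 1) X := by
  constructor
  · exact fun h n ↦ (subsingleton_extGroup_succ_iff_s8 A n _ _).1 (h _ n.succ_pos)
  · rintro h (_ | n) hi
    · exact absurd hi (lt_irrefl _)
    · exact (subsingleton_extGroup_succ_iff_s8 A n _ _).2 (h n)

lemma extVanishes_iff {n : ℕ} : ExtVanishes A n X ↔
    ∀ a : Abelian.Ext.{0} (ModuleCat.of A X) (ModuleCat.of A A) n, a = 0 :=
  ⟨fun h a ↦ @Subsingleton.elim _ h a 0, fun h ↦ ⟨fun a b ↦ by rw [h a, h b]⟩⟩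

lemma extVanishes_of_projective [Module.Projective A X] (n : ℕ) : ExtVanishes A (n + 1) X :=
  extVanishes_iff.2 fun a ↦ Abelian.Ext.eq_zero_of_projective a

lemma ExtVanishes.of_equiv {n : ℕ} (e : X ≃ₗ[A] Y) (h : ExtVanishes A n X) :
    ExtVanishes A n Y := by
  rw [extVanishes_iff] at *
  intro a
  have h' := h ((Abelian.Ext.mk₀ e.toModuleIso.hom).comp a (zero_add n))
  have h'' : (Abelian.Ext.mk₀ e.toModuleIso.inv).comp
      ((Abelian.Ext.mk₀ e.toModuleIso.hom).comp a (zero_add n)) (zero_add n) = a := by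
    rw [Abelian.Ext.mk₀_comp_mk₀_assoc, Iso.inv_hom_id, Abelian.Ext.mk₀_id_comp]
  rw [← h'', h', Abelian.Ext.comp_zero]

variable {f : X →ₗ[A] Y} {g : Y →ₗ[A] Z}

/-- Linear maps forming a short exact sequence give a short exact complex in `ModuleCat A`. -/
lemma exists_shortExact (hf : Function.Injective f) (hg : Function.Surjective g)
    (hfg : Function.Exact f g) :
    ∃ h, (ShortComplex.mk (ModuleCat.ofHom f) (ModuleCat.ofHom g) h).ShortExact := by
  refine ⟨by ext x; exact hfg.apply_apply_eq_zero x, ?_⟩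
  refine @ShortComplex.ShortExact.mk _ _ _ _ ?_ ((ModuleCat.mono_iff_injective _).2 hf)
    ((ModuleCat.epi_iff_surjective _).2 hg)
  exact (ShortComplex.ShortExact.moduleCat_exact_iff_function_exact _).2 hfg

lemma ExtVanishes.middle {n : ℕ} (hf : Function.Injective f) (hg : Function.Surjective g)
    (hfg : Function.Exact f g) (hX : ExtVanishes A n X) (hZ : ExtVanishes A n Z) :
    ExtVanishes A n Y := by
  obtain ⟨_, hS⟩ := exists_shortExact hf hg hfg
  rw [extVanishes_iff] at *
  intro a
  obtain ⟨b, rfl⟩ := Abelian.Ext.contravariant_sequence_exact₂ hS _ a (hX _)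
  rw [hZ b, Abelian.Ext.comp_zero]

lemma ExtVanishes.left {n : ℕ} (hf : Function.Injective f) (hg : Function.Surjective g)
    (hfg : Function.Exact f g) (hY : ExtVanishes A n Y) (hZ : ExtVanishes A (n + 1) Z) :
    ExtVanishes A n X := by
  obtain ⟨_, hS⟩ := exists_shortExact hf hg hfg
  rw [extVanishes_iff] at *
  intro a
  obtain ⟨b, rfl⟩ := Abelian.Ext.contravariant_sequence_exact₁ hS _ a (add_comm 1 n) (hZ _)
  rw [hY b, Abelian.Ext.comp_zero]

lemma ExtVanishes.right {n : ℕ} (hf : Function.Injective f) (hg : Function.Surjective g)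
    (hfg : Function.Exact f g) (hX : ExtVanishes A n X) (hY : ExtVanishes A (n + 1) Y) :
    ExtVanishes A (n + 1) Z := by
  obtain ⟨_, hS⟩ := exists_shortExact hf hg hfg
  rw [extVanishes_iff] at *
  intro a
  obtain ⟨b, rfl⟩ := Abelian.Ext.contravariant_sequence_exact₃ hS _ a (hY _) (add_comm 1 n)
  rw [hX b, Abelian.Ext.comp_zero]

lemma ExtVanishes.exists_extension (hf : Function.Injective f) (hg : Function.Surjective g)
    (hfg : Function.Exact f g) (hZ : ExtVanishes A 1 Z) (φ : X →ₗ[A] A) :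
    ∃ ψ : Y →ₗ[A] A, ψ ∘ₗ f = φ := by
  obtain ⟨_, hS⟩ := exists_shortExact hf hg hfg
  rw [extVanishes_iff] at *
  obtain ⟨b, hb⟩ := Abelian.Ext.contravariant_sequence_exact₁ hS _
    (Abelian.Ext.mk₀ (ModuleCat.ofHom φ)) (add_comm 1 0) (hZ _)
  obtain ⟨ψ, rfl⟩ := Abelian.Ext.addEquiv₀.symm.surjective b
  refine ⟨ψ.hom, ?_⟩
  rw [Abelian.Ext.addEquiv₀_symm_apply, Abelian.Ext.mk₀_comp_mk₀] at hb
  have := (Abelian.Ext.mk₀_bijective _ _).1 hb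
  exact congrArg ModuleCat.Hom.hom this

lemma ExtVanishes.of_exists_extension (hf : Function.Injective f) (hg : Function.Surjective g)
    (hfg : Function.Exact f g) (hY : ExtVanishes A 1 Y)
    (h : ∀ φ : X →ₗ[A] A, ∃ ψ : Y →ₗ[A] A, ψ ∘ₗ f = φ) : ExtVanishes A 1 Z := by
  obtain ⟨_, hS⟩ := exists_shortExact hf hg hfg
  rw [extVanishes_iff] at *
  intro a
  obtain ⟨b, rfl⟩ := Abelian.Ext.contravariant_sequence_exact₃ hS _ a (hY _) (add_comm 1 0)
  obtain ⟨φ, rfl⟩ := Abelian.Ext.addEquiv₀.symm.surjective b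
  obtain ⟨ψ, hψ⟩ := h φ.hom
  have : φ = ModuleCat.ofHom f ≫ ModuleCat.ofHom ψ := by
    ext x
    exact (LinearMap.congr_fun hψ x).symm
  rw [Abelian.Ext.addEquiv₀_symm_apply, this, ← Abelian.Ext.mk₀_comp_mk₀,
    hS.extClass_comp_assoc]

end ExtVanishes

lemma LinearMap.exists_comp_eq_of_surjective {A X Y Z : Type*} [Ring A] [AddCommGroup X]
    [Module A X] [AddCommGroup Y] [Module A Y] [AddCommGroup Z] [Module A Z] {q : X →ₗ[A] Y}
    (hq : Function.Surjective q) (φ : X →ₗ[A] Z) (h : ∀ v, q v = 0 → φ v = 0) :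
    ∃ ψ : Y →ₗ[A] Z, ∀ v, ψ (q v) = φ v := by
  refine ⟨(LinearMap.ker q).liftQ φ (fun v hv ↦ h v hv) ∘ₗ
    (q.quotKerEquivOfSurjective hq).symm.toLinearMap, fun v ↦ ?_⟩
  have : (q.quotKerEquivOfSurjective hq).symm (q v) = (LinearMap.ker q).mkQ v := by
    rw [LinearEquiv.symm_apply_eq]; rfl
  rw [LinearMap.comp_apply, LinearEquiv.coe_coe, this]
  rfl

/-- `π : N → N'` identifies `N'` with `N / xN`. -/
structure IsReduction {R N N' : Type} [CommRing R] [AddCommGroup N] [Module R N]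
    [AddCommGroup N'] [Module R N'] (x : R) (π : N →ₗ[R] N') : Prop where
  surjective : Function.Surjective π
  apply_eq_zero_iff : ∀ v, π v = 0 ↔ ∃ w, v = x • w

namespace IsReduction

section

variable {R S : Type} [CommRing R] [CommRing S] [Algebra R S] {x : R}

lemma algebraMap_surjective (hS : IsReduction x (Algebra.linearMap R S)) :
    Function.Surjective (algebraMap R S) := hS.surjective

lemma algebraMap_eq_zero_iff (hS : IsReduction x (Algebra.linearMap R S)) (r : R) :
    algebraMap R S r = 0 ↔ ∃ s, r = x * s :=
  hS.apply_eq_zero_iff r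

lemma algebraMap_self (hS : IsReduction x (Algebra.linearMap R S)) : algebraMap R S x = 0 :=
  (hS.algebraMap_eq_zero_iff x).2 ⟨1, (mul_one x).symm⟩

lemma smul_eq_zero (hS : IsReduction x (Algebra.linearMap R S))
    {M : Type} [AddCommGroup M] [Module R M] [Module S M] [IsScalarTower R S M]
    (m : M) : x • m = 0 := by
  rw [← algebraMap_smul S x m, hS.algebraMap_self, zero_smul]

lemma mk_tensor (hS : IsReduction x (Algebra.linearMap R S))
    (N : Type) [AddCommGroup N] [Module R N] :
    IsReduction x (TensorProduct.mk R S N 1) := by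
  refine ⟨TensorProduct.mk_surjective R N S hS.surjective, fun v ↦ ?_⟩
  constructor
  · intro h
    have hex : Function.Exact (LinearMap.lsmul R R x) (Algebra.linearMap R S) := by
      intro r
      rw [hS.apply_eq_zero_iff]
      exact ⟨fun ⟨s, hs⟩ ↦ ⟨s, hs.symm⟩, fun ⟨s, hs⟩ ↦ ⟨s, hs.symm⟩⟩
    have := rTensor_exact N hex hS.surjective
    obtain ⟨t, ht⟩ := (this (1 ⊗ₜ[R] v)).1 (by simpa using h)
    refine ⟨TensorProduct.lid R N t, ?_⟩
    have h2 : ∀ t : TensorProduct R R N, TensorProduct.lid R N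
        ((LinearMap.lsmul R R x).rTensor N t) = x • TensorProduct.lid R N t := by
      intro t
      induction t with
      | zero => simp
      | tmul a b => simp [mul_smul]
      | add a b ha hb => simp [ha, hb]
    rw [← h2, ht]
    simp
  · rintro ⟨w, rfl⟩
    rw [map_smul]
    exact hS.smul_eq_zero (TensorProduct.mk R S N 1 w)

lemma exists_eq_smul (hS : IsReduction x (Algebra.linearMap R S)) (hx : x ∈ nonZeroDivisors R)
    {N : Type} [AddCommGroup N] [Module R N] (f : N →ₗ[R] R) (h : ∀ v, algebraMap R S (f v) = 0) :
    ∃ g : N →ₗ[R] R, f = x • g := by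
  choose g hg using fun v ↦ (hS.algebraMap_eq_zero_iff (f v)).1 (h v)
  refine ⟨⟨⟨g, fun v w ↦ ?_⟩, fun r v ↦ ?_⟩, LinearMap.ext hg⟩
  · rw [← mul_cancel_left_mem_nonZeroDivisors hx, ← hg, map_add, hg v, hg w, mul_add]
  · rw [← mul_cancel_left_mem_nonZeroDivisors hx, ← hg, map_smul, hg v]
    simp only [smul_eq_mul, RingHom.id_apply]
    ring

end

variable {R S : Type} [CommRing R] [CommRing S] [Algebra R S] {x : R}
  {N N' : Type} [AddCommGroup N] [Module R N] [AddCommGroup N'] [Module R N'] [Module S N']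
  [IsScalarTower R S N'] {π : N →ₗ[R] N'}

lemma exists_desc (hS : IsReduction x (Algebra.linearMap R S)) (hπ : IsReduction x π)
    {L : Type} [AddCommGroup L] [Module R L] [Module S L] [IsScalarTower R S L] (φ : N →ₗ[R] L) :
    ∃ ψ : N' →ₗ[S] L, ∀ v, ψ (π v) = φ v := by
  obtain ⟨ψ, hψ⟩ := LinearMap.exists_comp_eq_of_surjective hπ.surjective φ (fun v hv ↦ by
    obtain ⟨w, rfl⟩ := (hπ.apply_eq_zero_iff v).1 hv
    rw [map_smul, hS.smul_eq_zero])
  exact ⟨LinearMap.extendScalarsOfSurjective hS.algebraMap_surjective ψ, hψ⟩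

lemma exists_dualMap (hS : IsReduction x (Algebra.linearMap R S)) (hπ : IsReduction x π) :
    ∃ ρ : Module.Dual R N →ₗ[R] Module.Dual S N', ∀ f v, ρ f (π v) = algebraMap R S (f v) := by
  choose ρ hρ using fun f : Module.Dual R N ↦ exists_desc hS hπ (Algebra.linearMap R S ∘ₗ f)
  refine ⟨⟨⟨ρ, fun f g ↦ ?_⟩, fun r f ↦ ?_⟩, fun f v ↦ hρ f v⟩
  · ext w
    obtain ⟨v, rfl⟩ := hπ.surjective w
    simp [hρ]
  · ext w
    obtain ⟨v, rfl⟩ := hπ.surjective w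
    simp [hρ, Algebra.smul_def]

lemma exists_lift (hS : IsReduction x (Algebra.linearMap R S)) (hx : x ∈ nonZeroDivisors R)
    (hN : ExtVanishes R 1 N) (φ : N →ₗ[R] S) :
    ∃ f : N →ₗ[R] R, ∀ v, algebraMap R S (f v) = φ v := by
  have hinj : Function.Injective (LinearMap.lsmul R R x) := fun a b hab ↦
    (mul_cancel_left_mem_nonZeroDivisors hx).1 hab
  have hex : Function.Exact (LinearMap.lsmul R R x) (Algebra.linearMap R S) := by
    intro r
    rw [hS.apply_eq_zero_iff]
    exact ⟨fun ⟨s, hs⟩ ↦ ⟨s, hs.symm⟩, fun ⟨s, hs⟩ ↦ ⟨s, hs.symm⟩⟩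
  obtain ⟨_, hE⟩ := exists_shortExact hinj hS.surjective hex
  obtain ⟨b, hb⟩ := Abelian.Ext.covariant_sequence_exact₃ (ModuleCat.of R N) hE
    (Abelian.Ext.mk₀ (ModuleCat.ofHom φ)) (zero_add 1) (extVanishes_iff.1 hN _)
  obtain ⟨f, rfl⟩ := Abelian.Ext.addEquiv₀.symm.surjective b
  refine ⟨f.hom, fun v ↦ ?_⟩
  rw [Abelian.Ext.addEquiv₀_symm_apply, Abelian.Ext.mk₀_comp_mk₀] at hb
  have := (Abelian.Ext.mk₀_bijective _ _).1 hb
  exact LinearMap.congr_fun (congrArg ModuleCat.Hom.hom this) v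

lemma dual (hS : IsReduction x (Algebra.linearMap R S)) (hx : x ∈ nonZeroDivisors R)
    (hN : ExtVanishes R 1 N) (hπ : IsReduction x π)
    {ρ : Module.Dual R N →ₗ[R] Module.Dual S N'} (hρ : ∀ f v, ρ f (π v) = algebraMap R S (f v)) :
    IsReduction x ρ := by
  constructor
  · intro g
    obtain ⟨f, hf⟩ := hS.exists_lift hx hN (g.restrictScalars R ∘ₗ π)
    refine ⟨f, LinearMap.ext fun w ↦ ?_⟩
    obtain ⟨v, rfl⟩ := hπ.surjective w
    rw [hρ, hf]
    rfl
  · intro f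
    constructor
    · intro h
      exact hS.exists_eq_smul hx f fun v ↦ by rw [← hρ, h, LinearMap.zero_apply]
    · rintro ⟨g, rfl⟩
      rw [map_smul]
      exact hS.smul_eq_zero (ρ g)

lemma exists_shortExact {K F K' F' : Type} [AddCommGroup K] [Module R K] [AddCommGroup F]
    [Module R F] [AddCommGroup K'] [Module R K'] [Module S K'] [IsScalarTower R S K']
    [AddCommGroup F'] [Module R F'] [Module S F'] [IsScalarTower R S F']
    {πK : K →ₗ[R] K'} {πF : F →ₗ[R] F'}
    (hS : IsReduction x (Algebra.linearMap R S)) (hπK : IsReduction x πK) (hπF : IsReduction x πF)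
    (hπ : IsReduction x π) (hN : IsSMulRegular N x)
    {i : K →ₗ[R] F} {q : F →ₗ[R] N} (hi : Function.Injective i) (hq : Function.Surjective q)
    (hiq : Function.Exact i q) :
    ∃ (i' : K' →ₗ[S] F') (q' : F' →ₗ[S] N'), (∀ k, i' (πK k) = πF (i k)) ∧
      Function.Injective i' ∧ Function.Surjective q' ∧ Function.Exact i' q' := by
  obtain ⟨i', hi'⟩ := exists_desc hS hπK (πF ∘ₗ i)
  obtain ⟨q', hq'⟩ := exists_desc hS hπF (π ∘ₗ q)
  simp only [LinearMap.comp_apply] at hi' hq'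
  refine ⟨i', q', hi', ?_, ?_, ?_⟩
  · rw [injective_iff_map_eq_zero]
    intro a ha
    obtain ⟨k, rfl⟩ := hπK.surjective a
    rw [hi', hπF.apply_eq_zero_iff] at ha
    obtain ⟨w, hw⟩ := ha
    have h0 : x • q w = x • 0 := by
      rw [← map_smul, ← hw, hiq.apply_apply_eq_zero, smul_zero]
    obtain ⟨k', rfl⟩ := (hiq w).1 (hN h0)
    exact (hπK.apply_eq_zero_iff k).2 ⟨k', hi (by rw [hw, map_smul])⟩
  · intro a
    obtain ⟨n, rfl⟩ := hπ.surjective a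
    obtain ⟨v, rfl⟩ := hq n
    exact ⟨πF v, hq' v⟩
  · intro a
    constructor
    · intro ha
      obtain ⟨v, rfl⟩ := hπF.surjective a
      rw [hq', hπ.apply_eq_zero_iff] at ha
      obtain ⟨n, hn⟩ := ha
      obtain ⟨w, rfl⟩ := hq n
      obtain ⟨k, hk⟩ := (hiq (v - x • w)).1 (by rw [map_sub, map_smul, hn, sub_self])
      refine ⟨πK k, ?_⟩
      rw [hi', hk, map_sub, map_smul, hS.smul_eq_zero, sub_zero]
    · rintro ⟨b, rfl⟩
      obtain ⟨k, rfl⟩ := hπK.surjective b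
      rw [hi', hq', hiq.apply_apply_eq_zero, map_zero]

end IsReduction

lemma Submodule.eq_top_of_forall_exists_add_smul {R M : Type*} [CommRing R] [IsLocalRing R]
    [AddCommGroup M] [Module R M] [Module.Finite R M] {x : R} (hx : x ∈ maximalIdeal R)
    (P : Submodule R M) (h : ∀ m, ∃ p ∈ P, ∃ n : M, m = p + x • n) : P = ⊤ := by
  have hJ : maximalIdeal R ≤ Ideal.jacobson ⊥ := (IsLocalRing.jacobson_eq_maximalIdeal ⊥
    bot_ne_top).ge
  refine top_le_iff.1 (Submodule.le_of_le_smul_of_le_jacobson_bot Module.Finite.fg_top hJ ?_)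
  intro m _
  obtain ⟨p, hp, n, rfl⟩ := h m
  exact Submodule.add_mem_sup hp (Submodule.smul_mem_smul hx trivial)

/-- A short exact sequence presenting a finite module by a finite free one. -/
lemma Module.Finite.exists_presentation (A M : Type) [CommRing A] [AddCommGroup M] [Module A M]
    [Module.Finite A M] : ∃ (n : ℕ) (q : (Fin n → A) →ₗ[A] M), Function.Surjective q ∧
      Function.Exact (LinearMap.ker q).subtype q := by
  obtain ⟨n, q, hq⟩ := Module.Finite.exists_fin' A M
  exact ⟨n, q, hq, LinearMap.exact_subtype_ker_map q⟩

lemma isSMulRegular_of_mem_nonZeroDivisors {R : Type} [CommRing R] {x : R}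
    (hx : x ∈ nonZeroDivisors R) (n : ℕ) (K : Submodule R (Fin n → R)) : IsSMulRegular K x := by
  intro a b hab
  ext i
  exact (mul_cancel_left_mem_nonZeroDivisors hx).1 (congrFun (congrArg Subtype.val hab) i)

section

variable {R S : Type} [CommRing R] [CommRing S] [Algebra R S] {x : R}

lemma isSMulRegular_dual {N : Type} [AddCommGroup N] [Module R N] (hx : x ∈ nonZeroDivisors R) :
    IsSMulRegular (Module.Dual R N) x := by
  intro f g hfg
  ext v
  exact (mul_cancel_left_mem_nonZeroDivisors hx).1 (LinearMap.congr_fun hfg v)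

namespace IsReduction

variable [IsNoetherianRing R]

lemma extVanishes (hS : IsReduction x (Algebra.linearMap R S)) (hx : x ∈ nonZeroDivisors R)
    (n : ℕ) {N N' : Type} [AddCommGroup N] [Module R N] [Module.Finite R N] [AddCommGroup N']
    [Module R N'] [Module S N'] [IsScalarTower R S N'] {π : N →ₗ[R] N'} (hπ : IsReduction x π)
    (hN : IsSMulRegular N x) (h : ∀ n, ExtVanishes R (n + 1) N) : ExtVanishes S (n + 1) N' := by
  induction n generalizing N N' with
  | zero =>
    obtain ⟨m, q, hq, hKq⟩ := Module.Finite.exists_presentation R N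
    have hK : ExtVanishes R 1 (LinearMap.ker q) :=
      (extVanishes_of_projective 0).left (Submodule.injective_subtype _) hq hKq (h 1)
    obtain ⟨i', q', hi', hinj, hsurj, hexact⟩ := exists_shortExact hS (hS.mk_tensor _)
      (hS.mk_tensor _) hπ hN (Submodule.injective_subtype _) hq hKq
    refine ExtVanishes.of_exists_extension hinj hsurj hexact (extVanishes_of_projective 0) ?_
    intro φ
    obtain ⟨f, hf⟩ := hS.exists_lift hx hK (φ.restrictScalars R ∘ₗ TensorProduct.mk R S _ 1)
    obtain ⟨g, rfl⟩ := (h 0).exists_extension (Submodule.injective_subtype _) hq hKq f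
    obtain ⟨ψ, hψ⟩ := exists_desc hS (hS.mk_tensor _) (Algebra.linearMap R S ∘ₗ g)
    refine ⟨ψ, LinearMap.ext fun w ↦ ?_⟩
    obtain ⟨v, rfl⟩ := (hS.mk_tensor _).surjective w
    rw [LinearMap.comp_apply, hi', hψ]
    exact hf v
  | succ n ih =>
    obtain ⟨m, q, hq, hKq⟩ := Module.Finite.exists_presentation R N
    obtain ⟨i', q', hi', hinj, hsurj, hexact⟩ := exists_shortExact hS (hS.mk_tensor _)
      (hS.mk_tensor _) hπ hN (Submodule.injective_subtype _) hq hKq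
    exact ExtVanishes.right hinj hsurj hexact (ih (hS.mk_tensor _)
      (isSMulRegular_of_mem_nonZeroDivisors hx _ _) fun n ↦
        (extVanishes_of_projective n).left (Submodule.injective_subtype _) hq hKq (h (n + 1)))
      (extVanishes_of_projective _)

variable [IsLocalRing R]

lemma extVanishes_of_reduction (hS : IsReduction x (Algebra.linearMap R S))
    (hx : x ∈ nonZeroDivisors R) (hxm : x ∈ maximalIdeal R)
    (n : ℕ) {N N' : Type} [AddCommGroup N] [Module R N] [Module.Finite R N] [AddCommGroup N']
    [Module R N'] [Module S N'] [IsScalarTower R S N'] {π : N →ₗ[R] N'} (hπ : IsReduction x π)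
    (hN : IsSMulRegular N x) (h : ∀ n, ExtVanishes S (n + 1) N') : ExtVanishes R (n + 1) N := by
  induction n generalizing N N' with
  | zero =>
    obtain ⟨m, q, hq, hKq⟩ := Module.Finite.exists_presentation R N
    obtain ⟨i', q', hi', hinj, hsurj, hexact⟩ := exists_shortExact hS (hS.mk_tensor _)
      (hS.mk_tensor _) hπ hN (Submodule.injective_subtype _) hq hKq
    refine ExtVanishes.of_exists_extension (Submodule.injective_subtype _) hq hKq
      (extVanishes_of_projective 0) ?_
    have : LinearMap.range (LinearMap.ker q).subtype.dualMap = ⊤ := by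
      refine Submodule.eq_top_of_forall_exists_add_smul hxm _ fun f ↦ ?_
      obtain ⟨φ, hφ⟩ := exists_desc hS (hS.mk_tensor _) (Algebra.linearMap R S ∘ₗ f)
      obtain ⟨ψ, rfl⟩ := (h 0).exists_extension hinj hsurj hexact φ
      obtain ⟨g, hg⟩ := hS.exists_lift hx (extVanishes_of_projective 0)
        (ψ.restrictScalars R ∘ₗ TensorProduct.mk R S (Fin m → R) 1)
      obtain ⟨k, hk⟩ := hS.exists_eq_smul hx (f - g ∘ₗ (LinearMap.ker q).subtype) fun v ↦ by
        have h1 := hφ v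
        rw [LinearMap.comp_apply, hi'] at h1
        have h2 := hg v
        simp only [LinearMap.sub_apply, LinearMap.comp_apply, map_sub]
        rw [sub_eq_zero]
        exact h1.symm.trans h2.symm
      exact ⟨_, ⟨g, rfl⟩, k, by rw [← hk]; exact (add_sub_cancel _ _).symm⟩
    intro φ
    obtain ⟨ψ, hψ⟩ := LinearMap.range_eq_top.1 this φ
    exact ⟨ψ, hψ⟩
  | succ n ih =>
    obtain ⟨m, q, hq, hKq⟩ := Module.Finite.exists_presentation R N
    obtain ⟨i', q', hi', hinj, hsurj, hexact⟩ := exists_shortExact hS (hS.mk_tensor _)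
      (hS.mk_tensor _) hπ hN (Submodule.injective_subtype _) hq hKq
    exact ExtVanishes.right (Submodule.injective_subtype _) hq hKq (ih (hS.mk_tensor _)
      (isSMulRegular_of_mem_nonZeroDivisors hx _ _) fun n ↦
        (extVanishes_of_projective n).left hinj hsurj hexact (h (n + 1)))
      (extVanishes_of_projective _)

lemma extVanishes_iff (hS : IsReduction x (Algebra.linearMap R S))
    (hx : x ∈ nonZeroDivisors R) (hxm : x ∈ maximalIdeal R)
    {N N' : Type} [AddCommGroup N] [Module R N] [Module.Finite R N] [AddCommGroup N']
    [Module R N'] [Module S N'] [IsScalarTower R S N'] {π : N →ₗ[R] N'} (hπ : IsReduction x π)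
    (hN : IsSMulRegular N x) :
    (∀ n, ExtVanishes R (n + 1) N) ↔ ∀ n, ExtVanishes S (n + 1) N' :=
  ⟨fun h n ↦ hS.extVanishes hx n hπ hN h, fun h n ↦ hS.extVanishes_of_reduction hx hxm n hπ hN h⟩

lemma bijective_eval_iff (hS : IsReduction x (Algebra.linearMap R S))
    (hx : x ∈ nonZeroDivisors R) (hxm : x ∈ maximalIdeal R)
    {N N' : Type} [AddCommGroup N] [Module R N] [Module.Finite R N] [AddCommGroup N']
    [Module R N'] [Module S N'] [IsScalarTower R S N'] {π : N →ₗ[R] N'} (hπ : IsReduction x π)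
    (h : ExtVanishes R 1 N) (h' : ExtVanishes R 1 (Module.Dual R N)) :
    Function.Bijective (Module.Dual.eval R N) ↔ Function.Bijective (Module.Dual.eval S N') := by
  obtain ⟨ρ, hρ⟩ := exists_dualMap hS hπ
  have hred := dual hS hx h hπ hρ
  constructor
  · rintro ⟨hi, hs⟩
    constructor
    · rw [injective_iff_map_eq_zero]
      intro a ha
      obtain ⟨v, rfl⟩ := hπ.surjective a
      obtain ⟨ψ, hψ⟩ := hS.exists_eq_smul hx (Module.Dual.eval R N v) fun f ↦ by
        rw [Module.Dual.eval_apply, ← hρ]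
        exact LinearMap.congr_fun ha (ρ f)
      obtain ⟨w, rfl⟩ := hs ψ
      rw [← map_smul] at hψ
      exact (hπ.apply_eq_zero_iff v).2 ⟨w, hi hψ⟩
    · intro Φ
      obtain ⟨F, hF⟩ := hS.exists_lift hx h' (Φ.restrictScalars R ∘ₗ ρ)
      obtain ⟨v, rfl⟩ := hs F
      refine ⟨π v, LinearMap.ext fun g ↦ ?_⟩
      obtain ⟨f, rfl⟩ := hred.surjective g
      exact (hρ f v).trans (hF f)
  · rintro ⟨hi, hs⟩
    constructor
    · rw [← LinearMap.ker_eq_bot]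
      have hJ : maximalIdeal R ≤ Ideal.jacobson ⊥ := (IsLocalRing.jacobson_eq_maximalIdeal ⊥
        bot_ne_top).ge
      refine Submodule.eq_bot_of_le_smul_of_le_jacobson_bot (maximalIdeal R) _
        (IsNoetherian.noetherian _) (fun v hv ↦ ?_) hJ
      have hv' : ∀ f : Module.Dual R N, f v = 0 := fun f ↦
        LinearMap.congr_fun (LinearMap.mem_ker.1 hv) f
      obtain ⟨w, rfl⟩ := (hπ.apply_eq_zero_iff v).1 <| hi <| by
        rw [map_zero]
        ext g
        obtain ⟨f, rfl⟩ := hred.surjective g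
        rw [Module.Dual.eval_apply, hρ, hv', map_zero, LinearMap.zero_apply]
      refine Submodule.smul_mem_smul hxm (LinearMap.mem_ker.2 (LinearMap.ext fun f ↦ ?_))
      have := hv' f
      rw [map_smul, smul_eq_mul] at this
      exact (mul_cancel_left_mem_nonZeroDivisors hx).1 (this.trans (mul_zero x).symm)
    · rw [← LinearMap.range_eq_top]
      refine Submodule.eq_top_of_forall_exists_add_smul hxm _ fun F ↦ ?_
      obtain ⟨Φ, hΦ⟩ := exists_desc hS hred (Algebra.linearMap R S ∘ₗ F)
      obtain ⟨a, rfl⟩ := hs Φ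
      obtain ⟨v, rfl⟩ := hπ.surjective a
      obtain ⟨k, hk⟩ := hS.exists_eq_smul hx (F - Module.Dual.eval R N v) fun f ↦ by
        have h1 := hΦ f
        rw [Module.Dual.eval_apply, hρ] at h1
        rw [LinearMap.sub_apply, map_sub, sub_eq_zero]
        exact h1.symm
      exact ⟨_, ⟨v, rfl⟩, k, by rw [← hk, add_sub_cancel]⟩

end IsReduction

end

lemma isTotallyReflexive_iff {A : Type} [CommRing A] {M : Type} [AddCommGroup M] [Module A M] :
    IsTotallyReflexive A M ↔ Module.Finite A M ∧ Function.Bijective (Module.Dual.eval A M) ∧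
      (∀ n, ExtVanishes A (n + 1) M) ∧ ∀ n, ExtVanishes A (n + 1) (Module.Dual A M) := by
  rw [IsTotallyReflexive, forall_extGroup_iff, forall_extGroup_iff]

section TotallyReflexive

variable {A X Y Z : Type} [CommRing A] [AddCommGroup X] [Module A X]
  [AddCommGroup Y] [Module A Y] [AddCommGroup Z] [Module A Z] {f : X →ₗ[A] Y} {g : Y →ₗ[A] Z}

lemma exact_dualMap (hg : Function.Surjective g) (hfg : Function.Exact f g) :
    Function.Exact g.dualMap f.dualMap := by
  intro φ
  constructor
  · intro h
    obtain ⟨ψ, hψ⟩ := LinearMap.exists_comp_eq_of_surjective hg φ fun v hv ↦ by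
      obtain ⟨w, rfl⟩ := (hfg v).1 hv
      exact LinearMap.congr_fun h w
    exact ⟨ψ, LinearMap.ext hψ⟩
  · rintro ⟨ψ, rfl⟩
    ext w
    simp [LinearMap.dualMap_apply, hfg.apply_apply_eq_zero]

lemma ExtVanishes.dualMap_surjective (hf : Function.Injective f) (hg : Function.Surjective g)
    (hfg : Function.Exact f g) (hZ : ExtVanishes A 1 Z) : Function.Surjective f.dualMap :=
  hZ.exists_extension hf hg hfg

/-- A quotient of a totally reflexive module by a totally reflexive submodule is totally reflexive
as soon as its positive `Ext` into the ring vanishes. -/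
lemma IsTotallyReflexive.of_shortExact (hf : Function.Injective f) (hg : Function.Surjective g)
    (hfg : Function.Exact f g) (hX : IsTotallyReflexive A X) (hY : IsTotallyReflexive A Y)
    (hZ : ∀ n, ExtVanishes A (n + 1) Z) : IsTotallyReflexive A Z := by
  rw [isTotallyReflexive_iff] at *
  obtain ⟨-, ⟨-, hXs⟩, -, hX'⟩ := hX
  obtain ⟨hYf, ⟨hYi, hYs⟩, -, hY'⟩ := hY
  have hfs := (hZ 0).dualMap_surjective hf hg hfg
  have hgi := LinearMap.dualMap_injective_of_surjective hg
  have hex := exact_dualMap hg hfg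
  refine ⟨Module.Finite.of_surjective g hg, ⟨?_, fun Φ ↦ ?_⟩, hZ,
    fun n ↦ (hY' n).left hgi hfs hex (hX' (n + 1))⟩
  · rw [injective_iff_map_eq_zero]
    intro z hz
    obtain ⟨y, rfl⟩ := hg z
    obtain ⟨Θ, hΘ⟩ := LinearMap.exists_comp_eq_of_surjective hfs (Module.Dual.eval A Y y)
      fun φ hφ ↦ by
        obtain ⟨ψ, rfl⟩ := (hex φ).1 hφ
        exact LinearMap.congr_fun hz ψ
    obtain ⟨w, rfl⟩ := hXs Θ
    have : f w = y := hYi (LinearMap.ext hΘ)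
    rw [← this, hfg.apply_apply_eq_zero]
  · obtain ⟨Ψ, rfl⟩ := (hX' 0).exists_extension hgi hfs hex Φ
    obtain ⟨y, rfl⟩ := hYs Ψ
    exact ⟨g y, rfl⟩

lemma IsTotallyReflexive.of_free (A : Type) [CommRing A] (n : ℕ) :
    IsTotallyReflexive A (Fin n → A) :=
  isTotallyReflexive_iff.2 ⟨inferInstance, Module.bijective_dual_eval A _,
    extVanishes_of_projective, extVanishes_of_projective⟩

end TotallyReflexive

/-- If the modules with vanishing positive `Ext` into the ring all embed into totally reflexive
modules with cokernel of the same kind, then they are totally reflexive. -/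
lemma propTR_of_exists_embedding (A : Type) [CommRing A]
    (h : ∀ (M : Type) [AddCommGroup M] [Module A M], Module.Finite A M →
      (∀ n, ExtVanishes A (n + 1) M) →
      ∃ (T C : ModuleCat.{0} A) (f : M →ₗ[A] T) (g : T →ₗ[A] C), Function.Injective f ∧
        Function.Surjective g ∧ Function.Exact f g ∧ IsTotallyReflexive A T ∧
        ∀ n, ExtVanishes A (n + 1) C) : PropTR A := by
  have hinj : ∀ (M : Type) [AddCommGroup M] [Module A M], Module.Finite A M →
      (∀ n, ExtVanishes A (n + 1) M) → Function.Injective (Module.Dual.eval A M) := by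
    intro M _ _ hM hE
    obtain ⟨T, C, f, g, hf, hg, hfg, hT, hC⟩ := h M hM hE
    rw [injective_iff_map_eq_zero]
    intro m hm
    apply hf
    apply hT.2.1.1
    rw [map_zero, map_zero]
    ext φ
    exact LinearMap.congr_fun hm (φ ∘ₗ f)
  have hsurj : ∀ (M : Type) [AddCommGroup M] [Module A M], Module.Finite A M →
      (∀ n, ExtVanishes A (n + 1) M) → Function.Surjective (Module.Dual.eval A M) := by
    intro M _ _ hM hE Φ
    obtain ⟨T, C, f, g, hf, hg, hfg, hT, hC⟩ := h M hM hE
    have := hT.1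
    obtain ⟨t, ht⟩ := hT.2.1.2 (Φ ∘ₗ f.dualMap)
    obtain ⟨m, rfl⟩ := (hfg t).1 <| hinj C (Module.Finite.of_surjective g hg) hC <| by
      rw [map_zero]
      ext φ
      refine (LinearMap.congr_fun ht (g.dualMap φ)).trans ?_
      rw [LinearMap.comp_apply, (exact_dualMap hg hfg).apply_apply_eq_zero, map_zero,
        LinearMap.zero_apply]
    refine ⟨m, LinearMap.ext fun φ ↦ ?_⟩
    obtain ⟨ψ, rfl⟩ := (hC 0).dualMap_surjective hf hg hfg φ
    exact LinearMap.congr_fun ht ψ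
  have hdual : ∀ (n : ℕ) (M : Type) [AddCommGroup M] [Module A M], Module.Finite A M →
      (∀ n, ExtVanishes A (n + 1) M) → ExtVanishes A (n + 1) (Module.Dual A M) := by
    intro n
    induction n with
    | zero =>
      intro M _ _ hM hE
      obtain ⟨T, C, f, g, hf, hg, hfg, hT, hC⟩ := h M hM hE
      have := hT.1
      refine ExtVanishes.of_exists_extension (LinearMap.dualMap_injective_of_surjective hg)
        ((hC 0).dualMap_surjective hf hg hfg) (exact_dualMap hg hfg)
        ((isTotallyReflexive_iff.1 hT).2.2.2 0) fun Φ ↦ ?_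
      obtain ⟨c, rfl⟩ := hsurj C (Module.Finite.of_surjective g hg) hC Φ
      obtain ⟨t, rfl⟩ := hg c
      exact ⟨Module.Dual.eval A T t, rfl⟩
    | succ n ih =>
      intro M _ _ hM hE
      obtain ⟨T, C, f, g, hf, hg, hfg, hT, hC⟩ := h M hM hE
      have := hT.1
      exact ExtVanishes.right (LinearMap.dualMap_injective_of_surjective hg)
        ((hC 0).dualMap_surjective hf hg hfg) (exact_dualMap hg hfg)
        (ih C (Module.Finite.of_surjective g hg) hC)
        ((isTotallyReflexive_iff.1 hT).2.2.2 (n + 1))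
  intro M _ _ hM hE
  rw [forall_extGroup_iff] at hE
  exact isTotallyReflexive_iff.2 ⟨hM, ⟨hinj M hM hE, hsurj M hM hE⟩, hE, fun n ↦ hdual n M hM hE⟩

section

variable {R S : Type} [CommRing R] [CommRing S] [Algebra R S] {x : R} [IsNoetherianRing R]
  [IsLocalRing R]

namespace IsReduction

lemma isTotallyReflexive_iff (hS : IsReduction x (Algebra.linearMap R S))
    (hx : x ∈ nonZeroDivisors R) (hxm : x ∈ maximalIdeal R)
    {N N' : Type} [AddCommGroup N] [Module R N] [Module.Finite R N] [AddCommGroup N']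
    [Module R N'] [Module S N'] [IsScalarTower R S N'] {π : N →ₗ[R] N'} (hπ : IsReduction x π)
    (hN : IsSMulRegular N x) : IsTotallyReflexive R N ↔ IsTotallyReflexive S N' := by
  have hfin : Module.Finite S N' :=
    have := Module.Finite.of_surjective π hπ.surjective
    Module.Finite.of_restrictScalars_finite R S N'
  rw [_root_.isTotallyReflexive_iff, _root_.isTotallyReflexive_iff]
  have key : (∀ n, ExtVanishes R (n + 1) N) →
      ((∀ n, ExtVanishes R (n + 1) (Module.Dual R N)) ↔
        ∀ n, ExtVanishes S (n + 1) (Module.Dual S N')) := by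
    intro h
    obtain ⟨ρ, hρ⟩ := exists_dualMap hS hπ
    exact extVanishes_iff hS hx hxm (dual hS hx (h 0) hπ hρ) (isSMulRegular_dual hx)
  rw [← extVanishes_iff hS hx hxm hπ hN]
  constructor
  · rintro ⟨-, h1, h2, h3⟩
    exact ⟨hfin, (bijective_eval_iff hS hx hxm hπ (h2 0) (h3 0)).1 h1, h2, (key h2).1 h3⟩
  · rintro ⟨-, h1, h2, h3⟩
    exact ⟨inferInstance, (bijective_eval_iff hS hx hxm hπ (h2 0) ((key h2).2 h3 0)).2 h1, h2,
      (key h2).2 h3⟩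

lemma propTR_of_reduction (hS : IsReduction x (Algebra.linearMap R S))
    (hx : x ∈ nonZeroDivisors R) (hxm : x ∈ maximalIdeal R) (h : PropTR S) : PropTR R := by
  intro M _ _ hM hE
  rw [forall_extGroup_iff] at hE
  obtain ⟨m, q, hq, hKq⟩ := Module.Finite.exists_presentation R M
  have hK : ∀ n, ExtVanishes R (n + 1) (LinearMap.ker q) := fun n ↦
    (extVanishes_of_projective n).left (Submodule.injective_subtype _) hq hKq (hE (n + 1))
  have hreg := isSMulRegular_of_mem_nonZeroDivisors hx m (LinearMap.ker q)
  have hred := hS.mk_tensor (LinearMap.ker q)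
  refine IsTotallyReflexive.of_shortExact (Submodule.injective_subtype _) hq hKq
    ((isTotallyReflexive_iff hS hx hxm hred hreg).2 (h _ inferInstance ?_))
    (IsTotallyReflexive.of_free R m) hE
  rw [forall_extGroup_iff]
  exact (extVanishes_iff hS hx hxm hred hreg).1 hK

lemma propTR (hS : IsReduction x (Algebra.linearMap R S))
    (hx : x ∈ nonZeroDivisors R) (hxm : x ∈ maximalIdeal R) (h : PropTR R) : PropTR S := by
  refine propTR_of_exists_embedding S fun M _ _ hM hE ↦ ?_
  let _ : Module R M := Module.compHom M (algebraMap R S)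
  have : IsScalarTower R S M := .of_algebraMap_smul fun _ _ ↦ rfl
  have : Module.Finite R S := Module.Finite.of_surjective _ hS.surjective
  have : Module.Finite R M := Module.Finite.trans S M
  obtain ⟨m, q, hq, hKq⟩ := Module.Finite.exists_presentation R M
  let N := LinearMap.ker q
  let F := Fin m → R
  have hN : IsSMulRegular N x := isSMulRegular_of_mem_nonZeroDivisors hx m N
  have hF : IsReduction x (TensorProduct.mk R S F 1) := hS.mk_tensor F
  have hNred : IsReduction x (TensorProduct.mk R S N 1) := hS.mk_tensor N
  obtain ⟨p, hp⟩ := exists_desc hS hF q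
  have hps : Function.Surjective p := fun a ↦ by
    obtain ⟨v, rfl⟩ := hq a
    exact ⟨_, hp v⟩
  have hpex : Function.Exact (LinearMap.ker p).subtype p := LinearMap.exact_subtype_ker_map p
  have hC : ∀ n, ExtVanishes S (n + 1) (LinearMap.ker p) := fun n ↦
    (extVanishes_of_projective n).left (Submodule.injective_subtype _) hps hpex (hE (n + 1))
  let κ : N →ₗ[R] LinearMap.ker p :=
    { toFun := fun v ↦ ⟨TensorProduct.mk R S F 1 v, (hp v).trans v.2⟩
      map_add' := fun v w ↦ Subtype.ext (map_add (TensorProduct.mk R S F 1) (v : F) w)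
      map_smul' := fun r v ↦ Subtype.ext (map_smul (TensorProduct.mk R S F 1) r (v : F)) }
  obtain ⟨g, hg⟩ := exists_desc (L := LinearMap.ker p) hS hNred κ
  have hxN : ∀ v : F, x • v ∈ N := fun v ↦ by
    rw [LinearMap.mem_ker, map_smul]
    exact hS.smul_eq_zero (q v)
  let μ : F →ₗ[R] N := LinearMap.codRestrict N (LinearMap.lsmul R F x) hxN
  obtain ⟨f₀, hf₀⟩ := LinearMap.exists_comp_eq_of_surjective hq (TensorProduct.mk R S N 1 ∘ₗ μ)
    fun v hv ↦ (hNred.apply_eq_zero_iff _).2 ⟨⟨v, hv⟩, rfl⟩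
  let f : M →ₗ[S] TensorProduct R S N :=
    LinearMap.extendScalarsOfSurjective hS.algebraMap_surjective f₀
  have hf : ∀ v, f (q v) = TensorProduct.mk R S N 1 (μ v) := hf₀
  have hfi : Function.Injective f := by
    rw [injective_iff_map_eq_zero]
    intro a ha
    obtain ⟨v, rfl⟩ := hq a
    rw [hf, hNred.apply_eq_zero_iff] at ha
    obtain ⟨w, hw⟩ := ha
    have : v = w := by
      ext i
      exact (mul_cancel_left_mem_nonZeroDivisors hx).1 (congrFun (congrArg Subtype.val hw) i)
    rw [this]
    exact w.2
  have hgs : Function.Surjective g := by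
    rintro ⟨a, ha⟩
    obtain ⟨v, rfl⟩ := hF.surjective a
    exact ⟨_, hg ⟨v, (hp v).symm.trans ha⟩⟩
  have hfg : Function.Exact f g := by
    intro a
    obtain ⟨v, rfl⟩ := hNred.surjective a
    rw [hg]
    constructor
    · intro hv
      obtain ⟨w, hw⟩ := (hF.apply_eq_zero_iff _).1 (congrArg Subtype.val hv)
      refine ⟨q w, ?_⟩
      rw [hf]
      congr 1
      exact Subtype.ext hw.symm
    · rintro ⟨b, hb⟩
      obtain ⟨w, rfl⟩ := hq b
      rw [← hg, ← hb, hf, hg]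
      exact Subtype.ext ((hF.apply_eq_zero_iff _).2 ⟨w, rfl⟩)
  have hT : ∀ n, ExtVanishes S (n + 1) (TensorProduct R S N) := fun n ↦
    (hE n).middle hfi hgs hfg (hC n)
  refine ⟨ModuleCat.of S (TensorProduct R S N), ModuleCat.of S (LinearMap.ker p), f, g, hfi, hgs,
    hfg, (isTotallyReflexive_iff hS hx hxm hNred hN).1 (h _ inferInstance ?_), hC⟩
  rw [forall_extGroup_iff]
  exact (extVanishes_iff hS hx hxm hNred hN).2 hT

end IsReduction

end

/-- for a regular element `x ∈ 𝔪`, `R` satisfies (tr) iff `R/(x)` does. -/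
theorem stmt8 (R : Type) [CommRing R] [IsLocalRing R] [IsNoetherianRing R]
    (x : R) (hx : x ∈ maximalIdeal R) (hreg : x ∈ nonZeroDivisors R) :
    PropTR R ↔ PropTR (R ⧸ Ideal.span {x}) := by
  have hS : IsReduction x (Algebra.linearMap R (R ⧸ Ideal.span {x})) :=
    ⟨Ideal.Quotient.mk_surjective, fun _ ↦
      Ideal.Quotient.eq_zero_iff_mem.trans Ideal.mem_span_singleton⟩
  exact ⟨hS.propTR hreg hx, hS.propTR_of_reduction hreg hx⟩
end

section
/- Let $R$ be a commutative noetherian local ring. Then every acyclic complex of finitely generated projective $R$-modules is totally acyclic if and only if every $\infty$-syzygy $R$-module is totally reflexive. -/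
open CategoryTheory IsLocalRing

section ExtOfResolution

/-- The projective resolution attached to a chain complex of projective objects that is exact in
positive degrees and is augmented onto `Z` exactly. -/
noncomputable def CategoryTheory.ProjectiveResolution.ofExact {C : Type*} [Category* C] [Abelian C]
    {Z : C}
    (K : ChainComplex C ℕ) [∀ n, Projective (K.X n)] (ε : K.X 0 ⟶ Z) [Epi ε]
    (w : K.d 1 0 ≫ ε = 0) (h₀ : (ShortComplex.mk _ _ w).Exact) (h : ∀ n, K.ExactAt (n + 1)) :
    ProjectiveResolution Z where
  complex := K
  π := (ChainComplex.toSingle₀Equiv _ _).symm ⟨ε, w⟩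
  quasiIso := ⟨fun n => by
    cases n with
    | zero =>
      rw [ChainComplex.quasiIsoAt₀_iff, ShortComplex.quasiIso_iff_of_zeros']
      · refine (ShortComplex.exact_and_epi_g_iff_of_iso ?_).2 ⟨h₀, by dsimp; infer_instance⟩
        exact ShortComplex.isoMk (Iso.refl _) (Iso.refl _) (Iso.refl _)
          (by simp; exact (Category.id_comp (K.d 1 0)).trans (Category.comp_id _).symm)
          (by simp; exact (Category.id_comp ε).trans (Category.comp_id _).symm)
      · simp; rfl
      all_goals rfl
    | succ n =>
      rw [quasiIsoAt_iff_exactAt' _ _ (ChainComplex.exactAt_succ_single_obj _ _)]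
      exact h n⟩

variable {R : Type} [CommRing R]

/-- The chain complex of modules attached to a sequence `⋯ → P 1 → P 0` of linear maps with
vanishing composites. -/
abbrev moduleChainComplex (P : ℕ → Type) [∀ i, AddCommGroup (P i)] [∀ i, Module R (P i)]
    (d : ∀ i, P (i + 1) →ₗ[R] P i) (h : ∀ i, d i ∘ₗ d (i + 1) = 0) :
    ChainComplex (ModuleCat.{0} R) ℕ :=
  ChainComplex.of (fun i => ModuleCat.of R (P i)) (fun i => ModuleCat.ofHom (d i)) fun i => by
    rw [← ModuleCat.ofHom_comp, h]
    rfl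

theorem moduleChainComplex_d (P : ℕ → Type) [∀ i, AddCommGroup (P i)] [∀ i, Module R (P i)]
    (d : ∀ i, P (i + 1) →ₗ[R] P i) (h : ∀ i, d i ∘ₗ d (i + 1) = 0) (i : ℕ) :
    (moduleChainComplex P d h).d (i + 1) i = ModuleCat.ofHom (d i) :=
  ChainComplex.of_d (fun i => ModuleCat.of R (P i)) (fun i => ModuleCat.ofHom (d i)) i

/-- Vanishing of `Ext` read off from a projective resolution. -/
theorem subsingleton_extGroup_succ_iff_s9 {M N : Type} [AddCommGroup M] [Module R M]
    [AddCommGroup N] [Module R N] (P : ℕ → Type)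
    [∀ i, AddCommGroup (P i)] [∀ i, Module R (P i)] [∀ i, Module.Projective R (P i)]
    (d : ∀ i, P (i + 1) →ₗ[R] P i) (ε : P 0 →ₗ[R] M) (hε : Function.Surjective ε)
    (h₀ : LinearMap.ker ε = LinearMap.range (d 0))
    (h : ∀ i, LinearMap.ker (d i) = LinearMap.range (d (i + 1))) (n : ℕ) :
    Subsingleton (ExtGroup R (n + 1) (ModuleCat.of R M) (ModuleCat.of R N)) ↔
      ∀ f : P (n + 1) →ₗ[R] N, f ∘ₗ d (n + 1) = 0 → ∃ g : P n →ₗ[R] N, g ∘ₗ d n = f := by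
  let K := moduleChainComplex P d fun i => LinearMap.range_le_ker_iff.1 (h i).ge
  have hd (i : ℕ) : K.d (i + 1) i = ModuleCat.ofHom (d i) := moduleChainComplex_d _ _ _ _
  have hK (i : ℕ) : Projective (K.X i) := inferInstanceAs (Projective (ModuleCat.of R (P i)))
  let ε' : K.X 0 ⟶ ModuleCat.of R M := ModuleCat.ofHom ε
  have : Epi ε' := (ModuleCat.epi_iff_surjective _).2 hε
  have w : K.d 1 0 ≫ ε' = 0 := by
    rw [hd 0]
    exact congr(ModuleCat.ofHom $(LinearMap.range_le_ker_iff.1 h₀.ge))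
  have e₀ : (ShortComplex.mk _ _ w).Exact := by
    rw [ShortComplex.moduleCat_exact_iff_range_eq_ker]
    change LinearMap.range (K.d 1 0).hom = LinearMap.ker ε
    rw [hd 0]
    exact h₀.symm
  have e (i : ℕ) : K.ExactAt (i + 1) := by
    rw [HomologicalComplex.exactAt_iff' _ (i + 2) (i + 1) i (by simp) (by simp),
      ShortComplex.moduleCat_exact_iff_range_eq_ker]
    change LinearMap.range (K.d (i + 2) (i + 1)).hom = LinearMap.ker (K.d (i + 1) i).hom
    rw [hd, hd]
    exact (h i).symm
  rw [ExtGroup, ← ModuleCat.isZero_iff_subsingleton,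
    ((ProjectiveResolution.ofExact K ε' w e₀ e).isoExt (n + 1) _).isZero_iff,
    ← HomologicalComplex.exactAt_iff_isZero_homology,
    HomologicalComplex.exactAt_iff' _ n (n + 1) (n + 2) (by simp) (by simp),
    ShortComplex.moduleCat_exact_iff]
  constructor
  · intro H f hf
    obtain ⟨g, hg⟩ := H (ModuleCat.ofHom f) (by
      change K.d (n + 2) (n + 1) ≫ ModuleCat.ofHom f = 0
      rw [hd]
      exact congr(ModuleCat.ofHom $hf))
    change K.d (n + 1) n ≫ g = ModuleCat.ofHom f at hg
    rw [hd] at hg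
    exact ⟨ModuleCat.Hom.hom g, congr(ModuleCat.Hom.hom $hg)⟩
  · intro H f hf
    change K.d (n + 2) (n + 1) ≫ f = 0 at hf
    rw [hd] at hf
    obtain ⟨g, hg⟩ := H (ModuleCat.Hom.hom f) congr(ModuleCat.Hom.hom $hf)
    refine ⟨ModuleCat.ofHom g, ?_⟩
    change K.d (n + 1) n ≫ ModuleCat.ofHom g = f
    rw [hd]
    exact congr(ModuleCat.ofHom $hg)

end ExtOfResolution

section TotalAcyclicity

variable {R : Type} [CommRing R]

/-- The differential of `C` between any two consecutive degrees. -/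
def FGProjComplex.dOf (C : FGProjComplex R) {m n : ℤ} (h : m + 1 = n) : C.X m →ₗ[R] C.X n :=
  match n, h with
  | _, rfl => C.d m

theorem FGProjComplex.Acyclic.ker_dOf {C : FGProjComplex R} (hC : C.Acyclic) {m n p : ℤ}
    (h₁ : m + 1 = n) (h₂ : n + 1 = p) :
    LinearMap.ker (C.dOf h₂) = LinearMap.range (C.dOf h₁) := by
  subst h₁ h₂
  exact hC m

theorem FGProjComplex.ker_dOf_eq (C : FGProjComplex R) {m n n' : ℤ} (h : m + 1 = n)
    (h' : m + 1 = n') : LinearMap.ker (C.dOf h) = LinearMap.ker (C.dOf h') := by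
  subst h h'
  rfl

theorem FGProjComplex.Acyclic.isInfiniteSyzygy_ker [IsLocalRing R] [IsNoetherianRing R]
    {C : FGProjComplex R} (hC : C.Acyclic) {m n : ℤ} (h : m + 1 = n) :
    IsInfiniteSyzygy R (LinearMap.ker (C.dOf h)) := by
  obtain ⟨m, rfl⟩ : ∃ m', m' + ((0 : ℕ) : ℤ) = m := ⟨m, by simp⟩
  have hfree (i : ℤ) : Module.Free R (C.X i) := Module.free_of_flat_of_isLocalRing
  let e (i : ℕ) := (Module.finBasis R (C.X (m + i))).equivFun
  have hs (i : ℕ) : m + (i : ℤ) + 1 = m + ((i + 1 : ℕ) : ℤ) := by push_cast; ring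
  have hker (i : ℕ) (x) : ((e (i + 1)).toLinearMap ∘ₗ C.dOf (hs i) ∘ₗ (e i).symm.toLinearMap) x = 0
      ↔ (e i).symm x ∈ LinearMap.ker (C.dOf (hs i)) := by
    simp
  refine ⟨inferInstance, fun i => Module.finrank R (C.X (m + i)),
    (e 0).toLinearMap ∘ₗ Submodule.subtype _,
    fun i => (e (i + 1)).toLinearMap ∘ₗ C.dOf (hs i) ∘ₗ (e i).symm.toLinearMap, ?_, ?_, ?_⟩
  · exact (e 0).injective.comp Subtype.val_injective
  · ext x
    rw [LinearMap.mem_ker, hker]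
    constructor
    · intro hx
      exact ⟨⟨(e 0).symm x, (C.ker_dOf_eq (hs 0) h).le hx⟩, by simp⟩
    · rintro ⟨y, rfl⟩
      rw [C.ker_dOf_eq (hs 0) h]
      simp
  · intro n
    ext x
    rw [LinearMap.mem_ker, hker, hC.ker_dOf (hs n) (hs (n + 1))]
    constructor
    · rintro ⟨y, hy⟩
      exact ⟨e n y, by simp [hy]⟩
    · rintro ⟨y, rfl⟩
      exact ⟨(e n).symm y, by simp⟩

theorem FGProjComplex.dualAcyclic_of_forall_subsingleton_extGroup {C : FGProjComplex R}
    (hC : C.Acyclic)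
    (H : ∀ (m n : ℤ) (h : m + 1 = n), Subsingleton
      (ExtGroup R 1 (ModuleCat.of R (LinearMap.ker (C.dOf h))) (ModuleCat.of R R))) :
    C.DualAcyclic := by
  intro n
  have hs (i : ℕ) : n + 2 - ((i + 1 : ℕ) : ℤ) + 1 = n + 2 - i := by push_cast; ring
  have h₀ : n + 2 - ((0 : ℕ) : ℤ) + 1 = n + 3 := by simp; ring
  have h₁ : n + 3 + 1 = n + 4 := by ring
  let ε : C.X (n + 2 - ((0 : ℕ) : ℤ)) →ₗ[R] LinearMap.ker (C.dOf h₁) :=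
    (C.dOf h₀).codRestrict _ fun x => by
      rw [hC.ker_dOf h₀ h₁]
      exact ⟨x, rfl⟩
  have key := (subsingleton_extGroup_succ_iff_s9 (N := R) (fun i : ℕ => C.X (n + 2 - i))
    (fun i => C.dOf (hs i)) ε
    (by
      rintro ⟨x, hx⟩
      rw [hC.ker_dOf h₀ h₁] at hx
      obtain ⟨y, hy⟩ := hx
      exact ⟨y, Subtype.ext hy⟩)
    (by rw [LinearMap.ker_codRestrict]; exact hC.ker_dOf (hs 0) h₀)
    (fun i => hC.ker_dOf (hs (i + 1)) (hs i)) 0).1 (H _ _ h₁)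
  have main {a b c : ℤ} (ha : a = n) (hab : a + 1 = b) (hbc : b + 1 = c)
      (hf : ∀ f : C.X b →ₗ[R] R, f ∘ₗ C.dOf hab = 0 → ∃ g : C.X c →ₗ[R] R, g ∘ₗ C.dOf hbc = f) :
      LinearMap.ker ((C.d n).dualMap) = LinearMap.range ((C.d (n + 1)).dualMap) := by
    subst ha hab hbc
    refine le_antisymm hf ?_
    rintro _ ⟨g, rfl⟩
    ext x
    exact (congr(g ($(C.dd a) x))).trans (map_zero g)
  exact main (by push_cast; ring) (hs 1) (hs 0) key

theorem exists_finite_free_resolution [IsNoetherianRing R] (M : Type) [AddCommGroup M] [Module R M]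
    [Module.Finite R M] :
    ∃ (k : ℕ → ℕ) (d : ∀ i, (Fin (k (i + 1)) → R) →ₗ[R] (Fin (k i) → R))
      (ε : (Fin (k 0) → R) →ₗ[R] M), Function.Surjective ε ∧
      LinearMap.ker ε = LinearMap.range (d 0) ∧
      ∀ i, LinearMap.ker (d i) = LinearMap.range (d (i + 1)) := by
  have step (s : Σ m : ℕ, Submodule R (Fin m → R)) :
      ∃ (m : ℕ) (g : (Fin m → R) →ₗ[R] (Fin s.1 → R)), LinearMap.range g = s.2 := by
    obtain ⟨m, g, hg⟩ := Module.Finite.exists_fin' R s.2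
    exact ⟨m, s.2.subtype ∘ₗ g, by
      rw [LinearMap.range_comp, LinearMap.range_eq_top.2 hg, Submodule.map_top,
        Submodule.range_subtype]⟩
  choose m g hg using step
  obtain ⟨m₀, ε, hε⟩ := Module.Finite.exists_fin' R M
  let s : ℕ → Σ m : ℕ, Submodule R (Fin m → R) :=
    fun n => n.rec ⟨m₀, LinearMap.ker ε⟩ fun _ t => ⟨m t, LinearMap.ker (g t)⟩
  exact ⟨fun i => (s i).1, fun i => g (s i), ε, hε, (hg (s 0)).symm, fun i => (hg (s (i + 1))).symm⟩

/-- The ranks of the splice of a left and a right sequence of free modules. -/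
def spliceRank (p q : ℕ → ℕ) : ℤ → ℕ
  | .ofNat n => q n
  | .negSucc n => p n

/-- The differentials of the splice of a left and a right sequence of free modules along a map. -/
def spliceD {p q : ℕ → ℕ} (dp : ∀ i, (Fin (p (i + 1)) → R) →ₗ[R] (Fin (p i) → R))
    (c : (Fin (p 0) → R) →ₗ[R] (Fin (q 0) → R))
    (dq : ∀ i, (Fin (q i) → R) →ₗ[R] (Fin (q (i + 1)) → R)) :
    ∀ n : ℤ, (Fin (spliceRank p q n) → R) →ₗ[R] (Fin (spliceRank p q (n + 1)) → R)
  | .ofNat n => dq n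
  | .negSucc 0 => c
  | .negSucc (n + 1) => dp n

theorem ker_spliceD {p q : ℕ → ℕ} (dp : ∀ i, (Fin (p (i + 1)) → R) →ₗ[R] (Fin (p i) → R))
    (c : (Fin (p 0) → R) →ₗ[R] (Fin (q 0) → R))
    (dq : ∀ i, (Fin (q i) → R) →ₗ[R] (Fin (q (i + 1)) → R))
    (hp : ∀ i, LinearMap.ker (dp i) = LinearMap.range (dp (i + 1)))
    (hpc : LinearMap.ker c = LinearMap.range (dp 0))
    (hcq : LinearMap.ker (dq 0) = LinearMap.range c)
    (hq : ∀ i, LinearMap.ker (dq (i + 1)) = LinearMap.range (dq i)) (n : ℤ) :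
    LinearMap.ker (spliceD dp c dq (n + 1)) = LinearMap.range (spliceD dp c dq n) :=
  match n with
  | .ofNat n => hq n
  | .negSucc 0 => hcq
  | .negSucc 1 => hpc
  | .negSucc (n + 2) => hp n

theorem PropTAC.isTotallyReflexive_of_isInfiniteSyzygy [IsNoetherianRing R] (hR : PropTAC R)
    {M : Type} [AddCommGroup M] [Module R M] (hM : IsInfiniteSyzygy R M) :
    IsTotallyReflexive R M := by
  obtain ⟨_, q, f, dq, hf, hf₀, hq⟩ := hM
  obtain ⟨p, dp, ε, hε, hε₀, hp⟩ := exists_finite_free_resolution (R := R) M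
  have hpc : LinearMap.ker (f ∘ₗ ε) = LinearMap.range (dp 0) := by
    rw [LinearMap.ker_comp_of_ker_eq_bot _ (LinearMap.ker_eq_bot.2 hf), hε₀]
  have hcq : LinearMap.ker (dq 0) = LinearMap.range (f ∘ₗ ε) := by
    rw [LinearMap.range_comp_of_range_eq_top _ (LinearMap.range_eq_top.2 hε), hf₀]
  have hker := ker_spliceD dp (f ∘ₗ ε) dq hp hpc hcq hq
  let C : FGProjComplex R :=
    { X := fun n => Fin (spliceRank p q n) → R
      d := spliceD dp (f ∘ₗ ε) dq
      dd := fun n => LinearMap.range_le_ker_iff.1 (hker n).ge }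
  have hC : C.DualAcyclic := hR C hker
  have hdp (i : ℕ) : LinearMap.ker (dp (i + 1)).dualMap = LinearMap.range (dp i).dualMap :=
    hC (.negSucc (i + 2))
  have hdp₀ : LinearMap.ker (dp 0).dualMap = LinearMap.range (f ∘ₗ ε).dualMap := hC (.negSucc 1)
  have hdc : LinearMap.ker (f ∘ₗ ε).dualMap = LinearMap.range (dq 0).dualMap := hC (.negSucc 0)
  have hdq (i : ℕ) : LinearMap.ker (dq i).dualMap = LinearMap.range (dq (i + 1)).dualMap :=
    hC (.ofNat i)
  have hεd : Function.Injective ε.dualMap := LinearMap.dualMap_injective_of_surjective hε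
  have hfd : Function.Surjective f.dualMap := by
    intro φ
    have : φ ∘ₗ ε ∈ LinearMap.ker (dp 0).dualMap := by
      change (φ ∘ₗ ε) ∘ₗ dp 0 = 0
      rw [LinearMap.comp_assoc, LinearMap.range_le_ker_iff.1 hε₀.ge, LinearMap.comp_zero]
    rw [hdp₀] at this
    obtain ⟨ψ, hψ⟩ := this
    exact ⟨ψ, hεd hψ⟩
  have hfd₀ : LinearMap.ker f.dualMap = LinearMap.range (dq 0).dualMap := by
    rw [← hdc, ← LinearMap.dualMap_comp_dualMap,
      LinearMap.ker_comp_of_ker_eq_bot _ (LinearMap.ker_eq_bot.2 hεd)]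
  have hev {m n : ℕ} (d : (Fin m → R) →ₗ[R] (Fin n → R))
      (φ : Module.Dual R (Module.Dual R (Fin m → R))) (hφ : φ ∘ₗ d.dualMap = 0) :
      ∃ x ∈ LinearMap.ker d, Module.Dual.eval R _ x = φ := by
    obtain ⟨x, rfl⟩ := (Module.bijective_dual_eval R (Fin m → R)).2 φ
    refine ⟨x, (Module.bijective_dual_eval R (Fin n → R)).1 ?_, rfl⟩
    rw [map_zero]
    exact hφ
  refine ⟨inferInstance, ⟨?_, ?_⟩, ?_, ?_⟩
  · intro x y hxy
    refine hf ((Module.bijective_dual_eval R (Fin (q 0) → R)).1 ?_)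
    ext φ
    exact congr($hxy (φ ∘ₗ f))
  · intro φ
    obtain ⟨x, hx, hxφ⟩ := hev (dq 0) (φ ∘ₗ f.dualMap) (by
      rw [LinearMap.comp_assoc, LinearMap.range_le_ker_iff.1 hfd₀.ge, LinearMap.comp_zero])
    rw [hf₀] at hx
    obtain ⟨m, rfl⟩ := hx
    refine ⟨m, LinearMap.ext fun ψ => ?_⟩
    obtain ⟨ψ, rfl⟩ := hfd ψ
    exact congr($hxφ ψ)
  · rintro (_ | i) hi
    · exact absurd hi (lt_irrefl _)
    · refine (subsingleton_extGroup_succ_iff_s9 (fun i => Fin (p i) → R) dp ε hε hε₀ hp i).2 ?_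
      exact fun φ hφ => (hdp i).le hφ
  · rintro (_ | i) hi
    · exact absurd hi (lt_irrefl _)
    · refine (subsingleton_extGroup_succ_iff_s9 (fun i => Module.Dual R (Fin (q i) → R))
        (fun i => (dq i).dualMap) f.dualMap hfd hfd₀ hdq i).2 fun φ hφ => ?_
      obtain ⟨x, hx, rfl⟩ := hev (dq (i + 1)) φ hφ
      rw [hq] at hx
      obtain ⟨y, rfl⟩ := hx
      exact ⟨Module.Dual.eval R _ y, rfl⟩

end TotalAcyclicity

/-- every acyclic complex of f.g. projectives is totally acyclic
iff every ∞-syzygy is totally reflexive. -/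
theorem stmt9 (R : Type) [CommRing R] [IsLocalRing R] [IsNoetherianRing R] :
    PropTAC R ↔
      ∀ (M : Type) [AddCommGroup M] [Module R M],
        IsInfiniteSyzygy R M → IsTotallyReflexive R M := by
  refine ⟨fun hR M _ _ hM => hR.isTotallyReflexive_of_isInfiniteSyzygy hM, fun H C hC => ?_⟩
  exact FGProjComplex.dualAcyclic_of_forall_subsingleton_extGroup hC fun m n h =>
    (H _ (hC.isInfiniteSyzygy_ker h)).2.2.1 1 one_pos
end

section
/- Let $R$ be a Gorenstein commutative noetherian local ring. Then every acyclic complex of finitely generated projective $R$-modules is totally acyclic. -/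
open CategoryTheory IsLocalRing

section ExtVanishing

variable {R : Type} [CommRing R]

/-- The derived-functor `Ext` vanishes in positive degree exactly when morphisms in the derived
category do. -/
lemma subsingleton_ext_of_subsingleton_extGroup (M N : ModuleCat.{0} R) (p : ℕ)
    (h : Subsingleton (ExtGroup R (p + 1) M N)) : Subsingleton (Abelian.Ext M N (p + 1)) := by
  let P := projectiveResolution M
  have hz : Limits.IsZero ((P.complex.linearYonedaObj R N).homology (p + 1)) :=
    (ModuleCat.isZero_iff_subsingleton.2 h).of_iso (P.isoExt (p + 1) N).symm
  rw [← HomologicalComplex.exactAt_iff_isZero_homology,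
    HomologicalComplex.exactAt_iff' _ p (p + 1) (p + 2) (by simp) (by simp),
    ShortComplex.moduleCat_exact_iff] at hz
  refine subsingleton_of_forall_eq 0 fun e ↦ ?_
  obtain ⟨f, hf, rfl⟩ := P.extMk_surjective e (p + 2) rfl
  rw [P.extMk_eq_zero_iff f (p + 2) rfl hf p rfl]
  exact hz f hf

section ShortExact

variable {N₁ N₂ N₃ : Type} [AddCommGroup N₁] [Module R N₁] [AddCommGroup N₂] [Module R N₂]
  [AddCommGroup N₃] [Module R N₃] {f : N₁ →ₗ[R] N₂} {g : N₂ →ₗ[R] N₃}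

lemma Function.Exact.shortExact_moduleCat (hfg : Function.Exact f g) (hf : Function.Injective f)
    (hg : Function.Surjective g) :
    (ModuleCat.shortComplexOfCompEqZero f g hfg.linearMap_comp_eq_zero).ShortExact :=
  ModuleCat.shortComplex_shortExact _ hfg hf hg

/-- In a short exact sequence, vanishing of `Ext` at the outer terms gives vanishing at the middle
term. -/
lemma subsingleton_ext_middle (hfg : Function.Exact f g) (hf : Function.Injective f)
    (hg : Function.Surjective g) (Y : ModuleCat.{0} R) (i : ℕ)
    (h₁ : Subsingleton (Abelian.Ext (ModuleCat.of R N₁) Y i))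
    (h₃ : Subsingleton (Abelian.Ext (ModuleCat.of R N₃) Y i)) :
    Subsingleton (Abelian.Ext (ModuleCat.of R N₂) Y i) := by
  refine subsingleton_of_forall_eq 0 fun e ↦ ?_
  obtain ⟨e₃, rfl⟩ := Abelian.Ext.contravariant_sequence_exact₂
    (hfg.shortExact_moduleCat hf hg) Y e (h₁.elim _ _)
  rw [h₃.elim e₃ 0, Abelian.Ext.comp_zero]

/-- If the middle term of a short exact sequence is projective, vanishing of `Ext` in degree
`i + 2` at the quotient gives vanishing in degree `i + 1` at the submodule. -/
lemma subsingleton_ext_left [Module.Projective R N₂] (hfg : Function.Exact f g)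
    (hf : Function.Injective f) (hg : Function.Surjective g) (Y : ModuleCat.{0} R) (i : ℕ)
    (h₃ : Subsingleton (Abelian.Ext (ModuleCat.of R N₃) Y (i + 2))) :
    Subsingleton (Abelian.Ext (ModuleCat.of R N₁) Y (i + 1)) := by
  have : Projective (ModuleCat.of R N₂) := (IsProjective.iff_projective _).1 inferInstance
  refine subsingleton_of_forall_eq 0 fun e ↦ ?_
  obtain ⟨e₂, rfl⟩ := Abelian.Ext.contravariant_sequence_exact₁
    (hfg.shortExact_moduleCat hf hg) Y e (n₁ := i + 2) (by lia) (h₃.elim _ _)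
  rw [Abelian.Ext.eq_zero_of_projective e₂, Abelian.Ext.comp_zero]

lemma exists_extension_of_subsingleton_ext_one (hfg : Function.Exact f g)
    (hf : Function.Injective f) (hg : Function.Surjective g)
    {Y : Type} [AddCommGroup Y] [Module R Y]
    (h₃ : Subsingleton (Abelian.Ext (ModuleCat.of R N₃) (ModuleCat.of R Y) 1))
    (φ : N₁ →ₗ[R] Y) : ∃ ψ : N₂ →ₗ[R] Y, ψ.comp f = φ := by
  obtain ⟨e, he⟩ := Abelian.Ext.contravariant_sequence_exact₁
    (hfg.shortExact_moduleCat hf hg) (ModuleCat.of R Y)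
    (Abelian.Ext.mk₀ (ModuleCat.ofHom φ)) (n₁ := 1) rfl (h₃.elim _ _)
  obtain ⟨ψ, rfl⟩ := (Abelian.Ext.mk₀_bijective _ _).2 e
  rw [Abelian.Ext.mk₀_comp_mk₀, (Abelian.Ext.mk₀_bijective _ _).1.eq_iff] at he
  exact ⟨ψ.hom, congrArg ModuleCat.Hom.hom he⟩

end ShortExact

variable [IsLocalRing R] [IsNoetherianRing R]

/-- If `x` in the maximal ideal is regular on `N`, then vanishing of `Ext` in degree `i + 1` for
`N / x N` gives vanishing in degree `i` for `N`. -/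
lemma subsingleton_ext_of_quotSMulTop (N Y : ModuleCat.{0} R) [Module.Finite R N]
    [Module.Finite R Y] {x : R} (hx : x ∈ maximalIdeal R) (reg : IsSMulRegular N x) (i : ℕ)
    (h : Subsingleton (Abelian.Ext (ModuleCat.of R (QuotSMulTop x N)) Y (i + 1))) :
    Subsingleton (Abelian.Ext N Y i) := by
  have hle : (⊤ : Submodule R (Abelian.Ext N Y i)) ≤ maximalIdeal R • ⊤ := by
    intro e _
    obtain ⟨e', rfl⟩ : ∃ e' : Abelian.Ext N Y i,
        (Abelian.Ext.mk₀ (x • 𝟙 N)).comp e' (zero_add i) = e :=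
      Abelian.Ext.contravariant_sequence_exact₁ reg.smulShortComplex_shortExact Y e
        (n₁ := i + 1) (by lia) (h.elim _ _)
    rw [Abelian.Ext.mk₀_smul, Abelian.Ext.smul_comp, Abelian.Ext.mk₀_id_comp]
    exact Submodule.smul_mem_smul hx trivial
  rw [← Submodule.subsingleton_iff R, ← subsingleton_iff_bot_eq_top]
  exact (Submodule.eq_bot_of_le_smul_of_le_jacobson_bot _ _ Module.Finite.fg_top hle
    (maximalIdeal_le_jacobson _)).symm

/-- If `Ext` from the residue field vanishes in all large degrees, so does `Ext` from every cyclic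
module. -/
lemma subsingleton_ext_of_surjective (Y : ModuleCat.{0} R) [Module.Finite R Y] (t : ℕ)
    (hk : ∀ i > t, Subsingleton (Abelian.Ext (ModuleCat.of R (ResidueField R)) Y i))
    {N : Type} [AddCommGroup N] [Module R N] (f : R →ₗ[R] N) (hf : Function.Surjective f) :
    ∀ i > t, Subsingleton (Abelian.Ext (ModuleCat.of R N) Y i) := by
  suffices H : ∀ I : Ideal R, ∀ (N : Type) [AddCommGroup N] [Module R N] (f : R →ₗ[R] N),
      Function.Surjective f → LinearMap.ker f = I →
      ∀ i > t, Subsingleton (Abelian.Ext (ModuleCat.of R N) Y i) from H _ N f hf rfl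
  intro I
  induction I using WellFoundedGT.induction with
  | ind I ih =>
  intro N _ _ f hf hI i hi
  have : Module.Finite R N := Module.Finite.of_surjective f hf
  have lt_ker {M : Type} [AddCommGroup M] [Module R M] (g : R →ₗ[R] M) (hle : I ≤ LinearMap.ker g)
      {x : R} (hxI : x ∉ I) (hx : g x = 0) : I < LinearMap.ker g :=
    lt_of_le_of_ne hle fun h ↦ hxI (h ▸ LinearMap.mem_ker.2 hx)
  have hmem (r : R) : f r = 0 ↔ r ∈ I := by rw [← hI, LinearMap.mem_ker]
  by_cases hprime : I.IsPrime
  · by_cases hmax : I = maximalIdeal R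
    · let e : (ResidueField R) ≃ₗ[R] N :=
        (Submodule.quotEquivOfEq _ _ (hmax.symm.trans hI.symm)).trans
          (f.quotKerEquivOfSurjective hf)
      refine subsingleton_ext_middle (f := e.toLinearMap) (g := (0 : N →ₗ[R] PUnit))
        ((e.toLinearMap.exact_zero_iff_surjective _).2 e.surjective) e.injective
        (Function.surjective_to_subsingleton _) Y i (hk i hi) ?_
      obtain ⟨j, rfl⟩ := Nat.exists_eq_add_of_lt hi
      have : Projective (ModuleCat.of R PUnit) :=
        (IsProjective.iff_projective _).1 inferInstance
      exact Abelian.Ext.subsingleton_of_projective _ _ _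
    · obtain ⟨x, hxm, hxI⟩ := SetLike.exists_of_lt
        (lt_of_le_of_ne (le_maximalIdeal hprime.ne_top) hmax)
      refine subsingleton_ext_of_quotSMulTop (ModuleCat.of R N) Y hxm ?_ i ?_
      · rw [isSMulRegular_iff_right_eq_zero_of_smul]
        intro n hn
        obtain ⟨r, rfl⟩ := hf n
        rw [← map_smul, hmem] at hn
        exact (hmem r).2 ((hprime.mem_or_mem hn).resolve_left hxI)
      · let g : R →ₗ[R] QuotSMulTop x N := (Submodule.mkQ _).comp f
        refine ih _ (lt_ker g (fun r hr ↦ ?_) hxI ?_) _ g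
          ((Submodule.mkQ_surjective _).comp hf) rfl _ (by lia)
        · simp [g, (hmem r).2 hr]
        · have : f x = x • f 1 := by rw [← map_smul, smul_eq_mul, mul_one]
          simp only [g, LinearMap.comp_apply, Submodule.mkQ_apply, Submodule.Quotient.mk_eq_zero,
            this]
          exact Submodule.smul_mem_pointwise_smul _ _ _ trivial
  · by_cases htop : I = ⊤
    · have : Subsingleton N := by
        refine subsingleton_of_forall_eq 0 fun n ↦ ?_
        obtain ⟨r, rfl⟩ := hf n
        exact (hmem r).2 (htop ▸ trivial)
      obtain ⟨j, rfl⟩ := Nat.exists_eq_add_of_lt hi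
      have : Projective (ModuleCat.of R N) :=
        (IsProjective.iff_projective _).1 inferInstance
      exact Abelian.Ext.subsingleton_of_projective _ _ _
    · obtain ⟨x, hxI, y, hyI, hxy⟩ : ∃ x ∉ I, ∃ y ∉ I, x * y ∈ I := by
        by_contra! h
        exact hprime ⟨htop, fun {x y} hxy ↦ by
          by_contra! h'
          exact h x h'.1 y h'.2 hxy⟩
      let g : R →ₗ[R] N := LinearMap.toSpanSingleton R N (f x)
      have hg (r : R) : g r = f (r * x) := by
        simp [g, ← map_smul]
      refine subsingleton_ext_middle (LinearMap.exact_subtype_mkQ (LinearMap.range g))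
        (Submodule.injective_subtype _) (Submodule.mkQ_surjective _) Y i ?_ ?_
      · refine ih (LinearMap.ker g) (lt_ker g (fun r hr ↦ ?_) hyI ?_) _ g.rangeRestrict
          g.surjective_rangeRestrict g.ker_rangeRestrict i hi
        · rw [LinearMap.mem_ker, hg, hmem]
          exact I.mul_mem_right _ hr
        · rwa [hg, hmem, mul_comm]
      · let q := (LinearMap.range g).mkQ.comp f
        refine ih _ (lt_ker q (fun r hr ↦ ?_) hxI ?_) _ q
          ((Submodule.mkQ_surjective _).comp hf) rfl i hi
        · simp [q, (hmem r).2 hr]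
        · simp only [q, LinearMap.comp_apply, Submodule.mkQ_apply, Submodule.Quotient.mk_eq_zero]
          exact ⟨1, by rw [hg, one_mul]⟩

/-- If `Ext` from the residue field vanishes in all large degrees, so does `Ext` from every
finitely generated module, with the same bound. -/
lemma subsingleton_ext_of_residueField (Y : ModuleCat.{0} R) [Module.Finite R Y] (t : ℕ)
    (hk : ∀ i > t, Subsingleton (Abelian.Ext (ModuleCat.of R (ResidueField R)) Y i))
    {N : Type} [AddCommGroup N] [Module R N] (hN : Module.Finite R N) :
    ∀ i > t, Subsingleton (Abelian.Ext (ModuleCat.of R N) Y i) := by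
  induction hN using IsNoetherianRing.induction_on_isQuotientEquivQuotientPrime R with
  | subsingleton N =>
    exact subsingleton_ext_of_surjective Y t hk 0 (Function.surjective_to_subsingleton _)
  | quotient N p e =>
    exact subsingleton_ext_of_surjective Y t hk (e.symm.toLinearMap.comp p.1.mkQ)
      (e.symm.surjective.comp (Submodule.mkQ_surjective _))
  | exact N₁ N₂ N₃ f g hf hg hfg h₁ h₃ =>
    exact fun i hi ↦ subsingleton_ext_middle hfg hf hg Y i (h₁ i hi) (h₃ i hi)

end ExtVanishing

namespace FGProjComplex

variable {R : Type} [CommRing R] {C : FGProjComplex R}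

lemma Acyclic.exact_range (hC : C.Acyclic) (n : ℤ) :
    Function.Exact (LinearMap.range (C.d n)).subtype (C.d (n + 1)).rangeRestrict := by
  rw [LinearMap.exact_iff, LinearMap.ker_rangeRestrict, Submodule.range_subtype, hC n]

/-- Vanishing of `Ext` from the syzygies of an acyclic complex in high degrees propagates down to
all positive degrees. -/
lemma Acyclic.subsingleton_ext_range (hC : C.Acyclic) (Y : ModuleCat.{0} R) (t : ℕ)
    (h : ∀ n, ∀ i > t, Subsingleton
      (Abelian.Ext (ModuleCat.of R (LinearMap.range (C.d n))) Y i)) (n : ℤ) (i : ℕ) :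
    Subsingleton (Abelian.Ext (ModuleCat.of R (LinearMap.range (C.d n))) Y (i + 1)) := by
  induction t with
  | zero => exact h n (i + 1) (by lia)
  | succ t ih =>
    refine ih fun n i hi ↦ ?_
    obtain ⟨j, rfl⟩ := Nat.exists_eq_add_of_lt hi
    exact subsingleton_ext_left (hC.exact_range n) (Submodule.injective_subtype _)
      (LinearMap.surjective_rangeRestrict _) Y (t + j) (h (n + 1) (t + j + 2) (by lia))

lemma Acyclic.dualAcyclic_of_subsingleton_ext (hC : C.Acyclic)
    (h : ∀ n, Subsingleton
      (Abelian.Ext (ModuleCat.of R (LinearMap.range (C.d n))) (ModuleCat.of R R) 1)) :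
    C.DualAcyclic := by
  intro n
  refine le_antisymm (fun φ hφ ↦ ?_) ?_
  · have hker : LinearMap.ker (C.d (n + 1)).rangeRestrict ≤ LinearMap.ker φ := by
      rw [LinearMap.ker_rangeRestrict, hC n]
      rintro _ ⟨x, rfl⟩
      exact LinearMap.congr_fun hφ x
    let e := (C.d (n + 1)).rangeRestrict.quotKerEquivOfSurjective
      (LinearMap.surjective_rangeRestrict _)
    obtain ⟨ψ, hψ⟩ := exists_extension_of_subsingleton_ext_one (hC.exact_range (n + 1))
      (Submodule.injective_subtype _) (LinearMap.surjective_rangeRestrict _) (h (n + 1 + 1))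
      (((LinearMap.ker (C.d (n + 1)).rangeRestrict).liftQ φ hker).comp e.symm.toLinearMap)
    refine ⟨ψ, LinearMap.ext fun x ↦ ?_⟩
    have hx := LinearMap.congr_fun hψ ((C.d (n + 1)).rangeRestrict x)
    have he : e.symm ((C.d (n + 1)).rangeRestrict x) = Submodule.Quotient.mk x :=
      e.symm_apply_eq.2 rfl
    simpa [he] using hx
  · rintro _ ⟨ψ, rfl⟩
    rw [LinearMap.mem_ker]
    ext x
    simp [LinearMap.dualMap_apply, show C.d (n + 1) (C.d n x) = 0 from
      LinearMap.congr_fun (C.dd n) x]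

end FGProjComplex

/-- over a Gorenstein local ring every acyclic complex of
f.g. projectives is totally acyclic. -/
theorem stmt11 (R : Type) [CommRing R] [IsLocalRing R] [IsNoetherianRing R]
    (hGor : IsGorensteinLocalRing R) : PropTAC R := by
  obtain ⟨t, ht⟩ := hGor
  refine fun C hC ↦ hC.dualAcyclic_of_subsingleton_ext fun n ↦
    hC.subsingleton_ext_range _ t (fun n ↦ ?_) n 0
  refine subsingleton_ext_of_residueField _ t (fun i hi ↦ ?_) inferInstance
  obtain ⟨j, rfl⟩ := Nat.exists_eq_add_of_lt hi
  exact subsingleton_ext_of_subsingleton_extGroup _ _ _ (ht _ hi)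
end

section
/- Let $(R,\mathfrak{m})$ be a commutative noetherian local ring and $x \in \mathfrak{m}$ an $R$-regular element. Then every acyclic complex of finitely generated projective $R$-modules is totally acyclic if and only if the same property holds for $R/(x)$. -/
open CategoryTheory IsLocalRing

open scoped TensorProduct

section RegularElement

variable {R : Type*} [CommRing R] {x : R}

theorem smul_eq_zero_of_projective (hreg : x ∈ nonZeroDivisors R) {M : Type*} [AddCommGroup M]
    [Module R M] [Module.Projective R M] {v : M} (hv : x • v = 0) : v = 0 := by
  have h : IsSMulRegular M x :=
    Module.Flat.isSMulRegular_of_isRegular (isRegular_iff_mem_nonZeroDivisors.mpr hreg)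
  exact h (by simpa using hv)

/-- A map out of a projective module whose values are all divisible by `x` is divisible by `x`. -/
theorem exists_eq_smul_of_forall_exists_eq_smul {P N : Type*} [AddCommGroup P] [Module R P]
    [Module.Projective R P] [AddCommGroup N] [Module R N] (g : P →ₗ[R] N)
    (hg : ∀ v, ∃ w, g v = x • w) : ∃ h : P →ₗ[R] N, ∀ v, g v = x • h v := by
  let m : N →ₗ[R] N := LinearMap.lsmul R N x
  obtain ⟨h, hh⟩ := Module.projective_lifting_property m.rangeRestrict
    (g.codRestrict (LinearMap.range m) fun v ↦ (hg v).imp fun _ hw ↦ hw.symm)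
    m.surjective_rangeRestrict
  exact ⟨h, fun v ↦ (congrArg Subtype.val (LinearMap.congr_fun hh v)).symm⟩

theorem Ideal.Quotient.exists_eq_mul_of_mk_eq_zero {r : R}
    (h : Ideal.Quotient.mk (Ideal.span {x}) r = 0) : ∃ c, r = x * c :=
  Ideal.mem_span_singleton.mp (Ideal.Quotient.eq_zero_iff_mem.mp h)

theorem exists_eq_smul_of_one_tmul_eq_zero {M : Type*} [AddCommGroup M] [Module R M] {v : M}
    (h : (1 : R ⧸ Ideal.span {x}) ⊗ₜ[R] v = 0) : ∃ w, v = x • w := by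
  have h' := congrArg (TensorProduct.quotTensorEquivQuotSMul M (Ideal.span {x})) h
  rw [← map_one (Ideal.Quotient.mk (Ideal.span {x})),
    TensorProduct.quotTensorEquivQuotSMul_mk_tmul, map_zero, one_smul,
    Submodule.Quotient.mk_eq_zero, Submodule.ideal_span_singleton_smul] at h'
  obtain ⟨w, -, hw⟩ := h'
  exact ⟨w, hw.symm⟩

theorem one_tmul_surjective (I : Ideal R) {M : Type*} [AddCommGroup M] [Module R M]
    (y : (R ⧸ I) ⊗[R] M) : ∃ v : M, (1 : R ⧸ I) ⊗ₜ[R] v = y :=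
  TensorProduct.mk_surjective R M (R ⧸ I) Ideal.Quotient.mk_surjective y

theorem smul_eq_zero_of_quotient {M : Type*} [AddCommGroup M] [Module (R ⧸ Ideal.span {x}) M]
    [Module R M] [IsScalarTower R (R ⧸ Ideal.span {x}) M] (m : M) : x • m = 0 := by
  have h0 : algebraMap R (R ⧸ Ideal.span {x}) x = 0 := by simp
  rw [← algebraMap_smul (R ⧸ Ideal.span {x}) x m, h0, zero_smul]

/-- A linear map to an `R ⧸ (x)`-module descends along a surjection onto an `R ⧸ (x)`-module
whose kernel is divisible by `x`. -/
theorem exists_eq_comp_of_quotient {F M N : Type*} [AddCommGroup F] [Module R F]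
    [AddCommGroup M] [Module (R ⧸ Ideal.span {x}) M] [Module R M]
    [IsScalarTower R (R ⧸ Ideal.span {x}) M] [AddCommGroup N] [Module (R ⧸ Ideal.span {x}) N]
    [Module R N] [IsScalarTower R (R ⧸ Ideal.span {x}) N] {q : F →ₗ[R] M}
    (hq : Function.Surjective q) (hker : ∀ v, q v = 0 → ∃ w, v = x • w) (g : F →ₗ[R] N) :
    ∃ G : M →ₗ[R ⧸ Ideal.span {x}] N, ∀ v, G (q v) = g v := by
  have hle : LinearMap.ker q ≤ LinearMap.ker g := fun v hv ↦ by
    obtain ⟨w, rfl⟩ := hker v hv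
    rw [LinearMap.mem_ker, map_smul, smul_eq_zero_of_quotient]
  let G : M →ₗ[R] N := (LinearMap.ker q).liftQ g hle ∘ₗ (q.quotKerEquivOfSurjective hq).symm
  refine ⟨G.extendScalarsOfSurjective Ideal.Quotient.mk_surjective, fun v ↦ ?_⟩
  have hv : (q.quotKerEquivOfSurjective hq).symm (q v) = Submodule.Quotient.mk v :=
    (LinearEquiv.symm_apply_eq _).mpr rfl
  change (LinearMap.ker q).liftQ g hle ((q.quotKerEquivOfSurjective hq).symm (q v)) = g v
  rw [hv, Submodule.liftQ_apply]

/-- A free module over `R ⧸ (x)` lifts to a free module over `R`. -/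
theorem exists_free_lift_of_quotient [Nontrivial (R ⧸ Ideal.span {x})] (M : Type*) [AddCommGroup M]
    [Module (R ⧸ Ideal.span {x}) M] [Module R M] [IsScalarTower R (R ⧸ Ideal.span {x}) M]
    [Module.Finite (R ⧸ Ideal.span {x}) M] [Module.Free (R ⧸ Ideal.span {x}) M] :
    ∃ (k : ℕ) (q : (Fin k → R) →ₗ[R] M), Function.Surjective q ∧
      (∀ v, q v = 0 → ∃ w, v = x • w) := by
  let b := Module.finBasis (R ⧸ Ideal.span {x}) M
  have key (v) : Fintype.linearCombination R b v
      = ∑ i, (Ideal.Quotient.mk (Ideal.span {x}) (v i)) • b i := by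
    rw [Fintype.linearCombination_apply]
    refine Finset.sum_congr rfl fun i _ ↦ ?_
    rw [← algebraMap_smul (R ⧸ Ideal.span {x}) (v i) (b i)]
    rfl
  refine ⟨_, Fintype.linearCombination R b, fun m ↦ ?_, fun v hv ↦ ?_⟩
  · choose c hc using fun i ↦ Ideal.Quotient.mk_surjective (b.repr m i)
    exact ⟨c, by simp [key, hc, b.sum_repr]⟩
  · rw [key] at hv
    have h i := Fintype.linearIndependent_iff.mp b.linearIndependent _ hv i
    choose w hw using fun i ↦ Ideal.Quotient.exists_eq_mul_of_mk_eq_zero (h i)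
    exact ⟨w, funext fun i ↦ hw i⟩

/-- Exactness of the dual of `A → B → C` at `B` can be checked after reduction modulo a
regular element of the maximal ideal. -/
theorem ker_dualMap_le_range_dualMap_of_quotient [IsLocalRing R] [IsNoetherianRing R]
    (hx : x ∈ maximalIdeal R) (hreg : x ∈ nonZeroDivisors R) {A B C : Type*}
    [AddCommGroup A] [Module R A] [AddCommGroup B] [Module R B] [Module.Finite R B]
    [Module.Projective R B] [AddCommGroup C] [Module R C] [Module.Projective R C]
    {d : A →ₗ[R] B} {e : B →ₗ[R] C} (hed : e ∘ₗ d = 0)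
    (hS : ∀ f : (R ⧸ Ideal.span {x}) ⊗[R] B →ₗ[R ⧸ Ideal.span {x}] R ⧸ Ideal.span {x},
      f ∘ₗ d.baseChange (R ⧸ Ideal.span {x}) = 0 →
      ∃ g : (R ⧸ Ideal.span {x}) ⊗[R] C →ₗ[R ⧸ Ideal.span {x}] R ⧸ Ideal.span {x},
        g ∘ₗ e.baseChange (R ⧸ Ideal.span {x}) = f) :
    LinearMap.ker d.dualMap ≤ LinearMap.range e.dualMap := by
  refine Submodule.le_of_le_smul_of_le_jacobson_bot (I := Ideal.span {x})
    (IsNoetherian.noetherian _) ?_ fun φ hφ ↦ ?_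
  · rw [IsLocalRing.jacobson_eq_maximalIdeal _ bot_ne_top, Ideal.span_singleton_le_iff_mem]
    exact hx
  have hφd (v) : φ (d v) = 0 := LinearMap.congr_fun hφ v
  have hed' (v) : e (d v) = 0 := LinearMap.congr_fun hed v
  obtain ⟨ψS, hψS⟩ := hS (Module.Dual.baseChange _ φ) (by
    refine LinearMap.ext fun y ↦ ?_
    obtain ⟨v, rfl⟩ := one_tmul_surjective _ y
    rw [LinearMap.comp_apply, LinearMap.baseChange_tmul, Module.Dual.baseChange_apply_tmul,
      hφd, zero_smul, LinearMap.zero_apply])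
  obtain ⟨ψ, hψ⟩ := Module.projective_lifting_property
    (Ideal.Quotient.mkₐ R (Ideal.span {x})).toLinearMap
    (ψS.restrictScalars R ∘ₗ TensorProduct.mk R (R ⧸ Ideal.span {x}) C 1)
    Ideal.Quotient.mk_surjective
  obtain ⟨θ, hθ⟩ := exists_eq_smul_of_forall_exists_eq_smul (x := x) (φ - ψ ∘ₗ e) fun v ↦ by
    refine Ideal.Quotient.exists_eq_mul_of_mk_eq_zero ?_
    have h1 : ψS (1 ⊗ₜ[R] e v) = Module.Dual.baseChange _ φ (1 ⊗ₜ[R] v) :=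
      LinearMap.congr_fun hψS (1 ⊗ₜ[R] v)
    have h2 : Ideal.Quotient.mk _ (ψ (e v)) = ψS (1 ⊗ₜ[R] e v) := LinearMap.congr_fun hψ (e v)
    have h3 : Module.Dual.baseChange (R ⧸ Ideal.span {x}) φ (1 ⊗ₜ[R] v)
        = Ideal.Quotient.mk _ (φ v) := by
      rw [Module.Dual.baseChange_apply_tmul]
      exact (Algebra.smul_def _ _).trans (mul_one _)
    rw [LinearMap.sub_apply, LinearMap.comp_apply, map_sub, h2, h1, h3, sub_self]
  have hθd : θ ∈ LinearMap.ker d.dualMap := by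
    refine LinearMap.ext fun v ↦ smul_eq_zero_of_projective hreg (M := R) ?_
    rw [LinearMap.dualMap_apply, ← hθ]
    simp [hφd, hed']
  have hsum : φ = e.dualMap ψ + x • θ := by
    refine LinearMap.ext fun v ↦ ?_
    have := hθ v
    rwa [LinearMap.sub_apply, sub_eq_iff_eq_add'] at this
  rw [hsum]
  exact Submodule.add_mem_sup ⟨ψ, rfl⟩
    (Submodule.smul_mem_smul (Ideal.mem_span_singleton_self x) hθd)

end RegularElement

namespace FGProjComplex

section Reduction

variable {R : Type} [CommRing R] {x : R}

/-- The extension of scalars of a complex along `R → R ⧸ I`. -/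
def modIdeal (C : FGProjComplex R) (I : Ideal R) : FGProjComplex (R ⧸ I) where
  X n := (R ⧸ I) ⊗[R] C.X n
  d n := (C.d n).baseChange (R ⧸ I)
  dd n := by rw [← LinearMap.baseChange_comp, C.dd, LinearMap.baseChange_zero]

theorem Acyclic.modIdeal_span_singleton (hreg : x ∈ nonZeroDivisors R) {C : FGProjComplex R}
    (hC : C.Acyclic) : (C.modIdeal (Ideal.span {x})).Acyclic := by
  intro n
  refine le_antisymm (fun y hy ↦ ?_) (LinearMap.range_le_ker_iff.mpr ((C.modIdeal _).dd n))
  obtain ⟨v, rfl⟩ := one_tmul_surjective _ y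
  obtain ⟨w, hw⟩ := exists_eq_smul_of_one_tmul_eq_zero (x := x) (v := C.d (n + 1) v) hy
  have hdw : C.d (n + 1 + 1) w = 0 := by
    refine smul_eq_zero_of_projective hreg ?_
    rw [← map_smul, ← hw]
    exact LinearMap.congr_fun (C.dd (n + 1)) v
  obtain ⟨u, hu⟩ := (hC (n + 1)).le hdw
  have hv : v - x • u ∈ LinearMap.ker (C.d (n + 1)) := by simp [hw, hu]
  obtain ⟨t, ht⟩ := (hC n).le hv
  refine ⟨(1 : R ⧸ Ideal.span {x}) ⊗ₜ[R] t, ?_⟩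
  have hx0 : (1 : R ⧸ Ideal.span {x}) ⊗ₜ[R] (x • u) = 0 := by
    have h : x • (1 : R ⧸ Ideal.span {x}) = 0 :=
      (Algebra.smul_def x _).trans (by simp)
    rw [← TensorProduct.smul_tmul, h, TensorProduct.zero_tmul]
  calc (1 : R ⧸ Ideal.span {x}) ⊗ₜ[R] C.d n t = 1 ⊗ₜ[R] (v - x • u) := by rw [ht]
    _ = 1 ⊗ₜ[R] v := by rw [TensorProduct.tmul_sub, hx0, sub_zero]

theorem range_dualMap_le_ker_dualMap (C : FGProjComplex R) (n : ℤ) :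
    LinearMap.range ((C.d (n + 1)).dualMap) ≤ LinearMap.ker ((C.d n).dualMap) := by
  rintro _ ⟨ψ, rfl⟩
  ext v
  simpa using congrArg ψ (LinearMap.congr_fun (C.dd n) v)

theorem DualAcyclic.of_modIdeal_span_singleton [IsLocalRing R] [IsNoetherianRing R]
    (hx : x ∈ maximalIdeal R) (hreg : x ∈ nonZeroDivisors R) {C : FGProjComplex R}
    (hC : (C.modIdeal (Ideal.span {x})).DualAcyclic) : C.DualAcyclic := fun n ↦
  (ker_dualMap_le_range_dualMap_of_quotient hx hreg (C.dd n) fun _ hf ↦ (hC n).le hf).antisymm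
    (C.range_dualMap_le_ker_dualMap n)

end Reduction

section Lifting

variable {R : Type} [CommRing R] {x : R} {F : ℤ → Type} [∀ n, AddCommGroup (F n)]
  [∀ n, Module R (F n)] [∀ n, Module.Finite R (F n)] [∀ n, Module.Projective R (F n)]

/-- The complex built from a sequence of maps `δ` with `δ ∘ δ = x • h`, where `h` commutes
with `δ`. -/
def ofSquareEqSMul (x : R) (δ : ∀ n, F n →ₗ[R] F (n + 1)) (h : ∀ n, F n →ₗ[R] F (n + 1 + 1))
    (hδ : ∀ n v, δ (n + 1) (δ n v) = x • h n v)
    (hcomm : ∀ n v, h (n + 1) (δ n v) = δ (n + 1 + 1) (h n v)) : FGProjComplex R where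
  X n := F n × F (n + 1)
  d n := ((δ n).coprod (x • LinearMap.id)).prod (-((h n).coprod (δ (n + 1))))
  dd n := by
    refine LinearMap.ext fun ⟨a, b⟩ ↦ Prod.ext ?_ ?_
    · simp [hδ]
    · simp [hδ, hcomm]

variable {D : FGProjComplex (R ⧸ Ideal.span {x})}
  [∀ n, Module R (D.X n)] [∀ n, IsScalarTower R (R ⧸ Ideal.span {x}) (D.X n)]
  {q : ∀ n, F n →ₗ[R] D.X n} {δ : ∀ n, F n →ₗ[R] F (n + 1)}
  {h : ∀ n, F n →ₗ[R] F (n + 1 + 1)} {hδ : ∀ n v, δ (n + 1) (δ n v) = x • h n v}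
  {hcomm : ∀ n v, h (n + 1) (δ n v) = δ (n + 1 + 1) (h n v)}

theorem Acyclic.ofSquareEqSMul (hreg : x ∈ nonZeroDivisors R) (hD : D.Acyclic)
    (hq : ∀ n, Function.Surjective (q n)) (hker : ∀ n v, q n v = 0 → ∃ w, v = x • w)
    (hqδ : ∀ n v, q (n + 1) (δ n v) = D.d n (q n v)) :
    (FGProjComplex.ofSquareEqSMul x δ h hδ hcomm).Acyclic := by
  intro n
  refine le_antisymm ?_ (LinearMap.range_le_ker_iff.mpr
    ((FGProjComplex.ofSquareEqSMul x δ h hδ hcomm).dd n))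
  rintro ⟨a, b⟩ hab
  have h1 : δ (n + 1) a + x • b = 0 := congrArg Prod.fst hab
  have hqa : q (n + 1) a ∈ LinearMap.ker (D.d (n + 1)) := by
    rw [LinearMap.mem_ker, ← hqδ, eq_neg_of_add_eq_zero_left h1, map_neg, map_smul,
      smul_eq_zero_of_quotient, neg_zero]
  obtain ⟨y, hy⟩ := (hD n).le hqa
  obtain ⟨c, rfl⟩ := hq n y
  obtain ⟨e, he⟩ := hker (n + 1) (a - δ n c) (by rw [map_sub, hqδ, hy, sub_self])
  obtain rfl : a = δ n c + x • e := by rw [← he]; abel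
  refine ⟨(c, e), Prod.ext rfl ?_⟩
  change -(h n c + δ (n + 1) e) = b
  rw [map_add, hδ, map_smul, ← smul_add, ← smul_add] at h1
  have := smul_eq_zero_of_projective hreg h1
  rw [neg_eq_iff_add_eq_zero, this]

theorem DualAcyclic.of_ofSquareEqSMul (hreg : x ∈ nonZeroDivisors R)
    (hq : ∀ n, Function.Surjective (q n)) (hker : ∀ n v, q n v = 0 → ∃ w, v = x • w)
    (hqδ : ∀ n v, q (n + 1) (δ n v) = D.d n (q n v))
    (hL : (FGProjComplex.ofSquareEqSMul x δ h hδ hcomm).DualAcyclic) : D.DualAcyclic := by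
  intro n
  obtain ⟨m, rfl⟩ : ∃ m, n = m + 1 := ⟨n - 1, by abel⟩
  refine le_antisymm (fun f hf ↦ ?_) (D.range_dualMap_le_ker_dualMap (m + 1))
  let π := (Ideal.Quotient.mkₐ R (Ideal.span {x})).toLinearMap
  have hf0 (v) : f (D.d (m + 1) v) = 0 := LinearMap.congr_fun hf v
  obtain ⟨φ, hφ⟩ := Module.projective_lifting_property π
    (f.restrictScalars R ∘ₗ q (m + 1 + 1)) Ideal.Quotient.mk_surjective
  have hφ' (v) : Ideal.Quotient.mk (Ideal.span {x}) (φ v) = f (q (m + 1 + 1) v) :=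
    LinearMap.congr_fun hφ v
  obtain ⟨ψ, hψ⟩ := exists_eq_smul_of_forall_exists_eq_smul (x := x) (φ ∘ₗ δ (m + 1)) fun v ↦
    Ideal.Quotient.exists_eq_mul_of_mk_eq_zero (by
      rw [LinearMap.comp_apply, hφ', hqδ, hf0])
  have hψδ (a) : ψ (δ m a) = φ (h m a) := by
    refine sub_eq_zero.mp (smul_eq_zero_of_projective hreg (M := R) ?_)
    rw [smul_sub, ← hψ, LinearMap.comp_apply, hδ, map_smul, sub_self]
  have hcocycle : ψ.coprod φ ∈
      LinearMap.ker (((FGProjComplex.ofSquareEqSMul x δ h hδ hcomm).d m).dualMap) := by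
    refine LinearMap.ext fun ⟨a, b⟩ ↦ ?_
    change ψ (δ m a + x • b) + φ (-(h m a + δ (m + 1) b)) = 0
    have hb : φ (δ (m + 1) b) = x • ψ b := hψ b
    rw [map_add, map_neg, map_add, map_smul, hψδ, hb]
    abel
  obtain ⟨μ, hμ⟩ : ∃ μ : Module.Dual R (F (m + 1 + 1) × F (m + 1 + 1 + 1)),
      ∀ a b, μ (δ (m + 1) a + x • b, -(h (m + 1) a + δ (m + 1 + 1) b)) = ψ a + φ b := by
    obtain ⟨μ, hμ⟩ := (hL m).le hcocycle
    exact ⟨μ, fun a b ↦ LinearMap.congr_fun hμ (a, b)⟩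
  let g : F (m + 1 + 1 + 1) →ₗ[R] R ⧸ Ideal.span {x} :=
    -(π ∘ₗ μ ∘ₗ LinearMap.inr R _ _)
  have hgf (b) : g (δ (m + 1 + 1) b) = f (q (m + 1 + 1) b) := by
    have hb : φ b = x • μ (b, 0) + μ (0, -δ (m + 1 + 1) b) := by
      rw [← map_smul, ← map_add]
      simpa using (hμ 0 b).symm
    rw [← hφ', hb, map_add, smul_eq_mul, map_mul,
      Ideal.Quotient.eq_zero_iff_mem.mpr (Ideal.mem_span_singleton_self x), zero_mul, zero_add]
    change -(π (μ (0, _))) = π (μ (0, _))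
    rw [← map_neg, ← map_neg, Prod.neg_mk, neg_zero]
    rfl
  obtain ⟨G, hG⟩ := exists_eq_comp_of_quotient (hq (m + 1 + 1 + 1)) (hker (m + 1 + 1 + 1)) g
  refine ⟨G, LinearMap.ext fun y ↦ ?_⟩
  obtain ⟨b, rfl⟩ := hq (m + 1 + 1) y
  rw [LinearMap.dualMap_apply, ← hqδ, hG, hgf]

theorem propTAC_quotient (hreg : x ∈ nonZeroDivisors R) [IsLocalRing (R ⧸ Ideal.span {x})]
    (hR : PropTAC R) : PropTAC (R ⧸ Ideal.span {x}) := by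
  intro D hD
  let _ (n) : Module R (D.X n) := Module.compHom _ (Ideal.Quotient.mk (Ideal.span {x}))
  have _ (n) : IsScalarTower R (R ⧸ Ideal.span {x}) (D.X n) :=
    ⟨fun r s m ↦ by
      rw [Algebra.smul_def, mul_smul]
      rfl⟩
  have _ (n) : Module.Free (R ⧸ Ideal.span {x}) (D.X n) := Module.free_of_flat_of_isLocalRing
  choose k q hq hker using fun n ↦ exists_free_lift_of_quotient (R := R) (x := x) (D.X n)
  choose δ hqδ' using fun n ↦ Module.projective_lifting_property (q (n + 1))
    ((D.d n).restrictScalars R ∘ₗ q n) (hq (n + 1))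
  have hqδ n v : q (n + 1) (δ n v) = D.d n (q n v) := LinearMap.congr_fun (hqδ' n) v
  choose h hδ using fun n ↦ exists_eq_smul_of_forall_exists_eq_smul (x := x)
    (δ (n + 1) ∘ₗ δ n) fun v ↦ hker _ _ (by
      rw [LinearMap.comp_apply, hqδ, hqδ]
      exact LinearMap.congr_fun (D.dd n) (q n v))
  have hcomm n v : h (n + 1) (δ n v) = δ (n + 1 + 1) (h n v) := by
    refine sub_eq_zero.mp (smul_eq_zero_of_projective hreg ?_)
    rw [smul_sub, ← hδ, ← map_smul, ← hδ]
    exact sub_self _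
  exact DualAcyclic.of_ofSquareEqSMul (hδ := hδ) (hcomm := hcomm) hreg hq hker hqδ
    (hR _ (Acyclic.ofSquareEqSMul hreg hD hq hker hqδ))

end Lifting

end FGProjComplex

/-- for a regular element `x ∈ 𝔪`, `R` satisfies (tac) iff `R/(x)` does. -/
theorem stmt12 (R : Type) [CommRing R] [IsLocalRing R] [IsNoetherianRing R]
    (x : R) (hx : x ∈ maximalIdeal R) (hreg : x ∈ nonZeroDivisors R) :
    PropTAC R ↔ PropTAC (R ⧸ Ideal.span {x}) := by
  have : Nontrivial (R ⧸ Ideal.span {x}) := Ideal.Quotient.nontrivial_iff.mpr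
    ((Ideal.span_singleton_eq_top.not).mpr hx)
  have : IsLocalRing (R ⧸ Ideal.span {x}) :=
    IsLocalRing.of_surjective' _ Ideal.Quotient.mk_surjective
  exact ⟨FGProjComplex.propTAC_quotient hreg, fun h C hC ↦
    .of_modIdeal_span_singleton hx hreg (h _ (hC.modIdeal_span_singleton hreg))⟩
end
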